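/- arXiv:2107.10819 — 2 statements merged into one kernel-verified Lean document; each statement's English description precedes it below -/
import Mathlib

section
/- Let n ≥ 1. The number of orbits of the group B_{n−1} acting on the set of complete flags in ℂⁿ equals the number of partitions of {1,…,n} into lists, i.e. the cardinality of the quotient of the set of complete flags in ℂⁿ by the B_{n−1}-orbit equivalence relation equals |PIL(n)|. -/
open scoped BigOperators

noncomputable section

/-- `P` is a partition of the finite set `A` into (nonempty, duplicate-free) lists:
every element of `A` appears exactly once in exactly one of the lists of `P`. -/
def IsPIL (A : Finset ℕ) (P : Finset (List ℕ)) : Prop :=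
  (∀ l ∈ P, l.Nodup ∧ l ≠ []) ∧
  (∀ l ∈ P, ∀ l' ∈ P, l ≠ l' → Disjoint l.toFinset l'.toFinset) ∧
  P.biUnion (fun l => l.toFinset) = A

/-- `|PIL(n)|`: the number of partitions of `{1, …, n}` into lists. -/
def pilCount (n : ℕ) : ℕ := Set.ncard {P : Finset (List ℕ) | IsPIL (Finset.Icc 1 n) P}

/-- Membership in the subgroup `B_{n-1}` of `GL(n, ℂ)`: invertible upper triangular matrices
`g` with `g ₙₙ = 1` and `g ᵢₙ = 0` for `i < n` (indices `0, …, n-1`; the last index plays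
the role of `n`). -/
def memB (n : ℕ) (g : Matrix (Fin n) (Fin n) ℂ) : Prop :=
  IsUnit g ∧
  (∀ i j : Fin n, (j : ℕ) < (i : ℕ) → g i j = 0) ∧
  (∀ i : Fin n, (i : ℕ) + 1 = n → g i i = 1) ∧
  (∀ i j : Fin n, (j : ℕ) + 1 = n → (i : ℕ) + 1 ≠ n → g i j = 0)

/-- A complete flag `V₁ ⊂ V₂ ⊂ ⋯ ⊂ Vₙ = ℂⁿ` in `ℂⁿ` (so `V i` has dimension `i + 1`
for the 0-indexed `i : Fin n`). -/
structure CompleteFlag (n : ℕ) where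
  V : Fin n → Submodule ℂ (Fin n → ℂ)
  mono : ∀ i j : Fin n, i ≤ j → V i ≤ V j
  dimV : ∀ i : Fin n, Module.finrank ℂ (V i) = (i : ℕ) + 1

/-- Two complete flags lie in the same `B_{n-1}`-orbit:
`F = g · F'` for some `g ∈ B_{n-1}`. -/
def flagRel (n : ℕ) (F F' : CompleteFlag n) : Prop :=
  ∃ g : Matrix (Fin n) (Fin n) ℂ, memB n g ∧
    ∀ i, (F'.V i).map (Matrix.toLin' g) = F.V i

def Dset (n : ℕ) : Set (Equiv.Perm (Fin n) × (Fin n → Bool)) :=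
  {p | (∀ i : Fin n, (i : ℕ) + 1 = n → p.2 i = true) ∧
    ∀ i j : Fin n, i < j → p.2 i = true → p.2 j = true → p.1 j < p.1 i}

def LLset (n : ℕ) : Set (List (List ℕ)) :=
  {L | (∀ l ∈ L, l ≠ []) ∧ L.flatten.Nodup ∧ (∀ x, x ∈ L.flatten ↔ 1 ≤ x ∧ x ≤ n) ∧
    L.Pairwise (fun l l' => l'.getLastD 0 < l.getLastD 0)}

def Mset (n : ℕ) : Set (List (ℕ × Bool)) :=
  {m | (m.map Prod.fst).Nodup ∧ (∀ x, x ∈ m.map Prod.fst ↔ 1 ≤ x ∧ x ≤ n) ∧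
    (∀ x ∈ m.getLast?, x.2 = true) ∧
    m.Pairwise (fun x y => x.2 = true → y.2 = true → y.1 < x.1)}

def encL : List ℕ → List (ℕ × Bool)
  | [] => []
  | [a] => [(a, true)]
  | a :: b :: t => (a, false) :: encL (b :: t)

def decM : List (ℕ × Bool) → List (List ℕ)
  | [] => []
  | (a, true) :: m => [a] :: decM m
  | (a, false) :: m => match decM m with
    | [] => [[a]]
    | l :: L => (a :: l) :: L

lemma encL_map : ∀ l, (encL l).map Prod.fst = l
  | [] => rfl
  | [a] => rfl
  | a :: b :: t => by simp [encL, encL_map (b :: t)]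

lemma encL_true : ∀ (l : List ℕ) (x : ℕ), (x, true) ∈ encL l ↔ l ≠ [] ∧ x = l.getLastD 0
  | [], x => by simp [encL]
  | [a], x => by simp [encL]
  | a :: b :: t, x => by
    have := encL_true (b :: t) x
    simp only [encL, List.mem_cons, Prod.mk.injEq]
    simp [this]

lemma encL_pw : ∀ (l : List ℕ),
    (encL l).Pairwise (fun x y => x.2 = true → y.2 = true → y.1 < x.1)
  | [] => by simp [encL]
  | [a] => by simp [encL]
  | a :: b :: t => by
    have := encL_pw (b :: t)
    simp [encL, this]

lemma dec_encL : ∀ (l : List ℕ) (m), l ≠ [] → decM (encL l ++ m) = l :: decM m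
  | [], _ => by simp
  | [a], m => by simp [encL, decM]
  | a :: b :: t, m => by
    intro _
    have := dec_encL (b :: t) m (by simp)
    simp [encL, decM, this]

lemma dec_enc (L : List (List ℕ)) (h : ∀ l ∈ L, l ≠ []) : decM (L.flatMap encL) = L := by
  induction L with
  | nil => rfl
  | cons l L ih =>
    rw [List.flatMap_cons, dec_encL _ _ (h l (by simp)), ih (fun x hx => h x (by simp [hx]))]

lemma dec_ne (m) : ∀ l ∈ decM m, l ≠ [] := by
  induction m with
  | nil => simp [decM]
  | cons x m ih =>
    obtain ⟨a, _ | _⟩ := x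
    · simp only [decM]
      split
      · simp
      · rename_i h
        rw [h] at ih
        simp at ih ⊢
        exact ih.2
    · simpa [decM] using ih

lemma enc_dec (m : List (ℕ × Bool)) (h : ∀ x ∈ m.getLast?, x.2 = true) :
    (decM m).flatMap encL = m := by
  induction m with
  | nil => rfl
  | cons x m ih =>
    obtain ⟨a, _ | _⟩ := x
    · rcases m with _ | ⟨y, m⟩
      · simp at h
      · have ih := ih (by simpa using h)
        have hne := dec_ne (y :: m)
        rw [decM]
        split
        · rename_i h
          rw [h] at ih
          simp at ih
        · rename_i l L h
          rw [h] at ih hne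
          rcases l with _ | ⟨b, t⟩
          · simp at hne
          · rw [← ih]
            simp [encL]
    · have ih := ih (by
        rcases m with _ | ⟨y, m⟩
        · simp
        · simpa using h)
      simp [decM, encL, ih]

lemma enc_map (L : List (List ℕ)) : (L.flatMap encL).map Prod.fst = L.flatten := by
  induction L with
  | nil => rfl
  | cons l L ih => simp [encL_map, ← ih]

lemma encL_last (l : List ℕ) (hl : l ≠ []) (m : List (ℕ × Bool))
    (h : ∀ x ∈ m.getLast?, x.2 = true) : ∀ x ∈ (encL l ++ m).getLast?, x.2 = true := by
  induction l with
  | nil => simp at hl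
  | cons a t ih =>
    rcases t with _ | ⟨b, t⟩
    · rcases m with _ | ⟨y, m⟩
      · simp [encL]
      · simpa [encL] using h
    · have := ih (by simp)
      rw [encL, List.cons_append]
      have h2 : encL (b :: t) ++ m ≠ [] := by
        rcases t with _ | ⟨c, t⟩ <;> simp [encL]
      obtain ⟨z, zs, hz⟩ := List.exists_cons_of_ne_nil h2
      rw [hz] at this ⊢
      simpa using this

lemma enc_last (L : List (List ℕ)) (h : ∀ l ∈ L, l ≠ []) :
    ∀ x ∈ (L.flatMap encL).getLast?, x.2 = true := by
  induction L with
  | nil => simp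
  | cons l L ih =>
    rw [List.flatMap_cons]
    exact encL_last l (h l (by simp)) _ (ih (fun x hx => h x (by simp [hx])))

lemma enc_pw (L : List (List ℕ)) (h : ∀ l ∈ L, l ≠ []) :
    (L.flatMap encL).Pairwise (fun x y => x.2 = true → y.2 = true → y.1 < x.1) ↔
    L.Pairwise (fun l l' => l'.getLastD 0 < l.getLastD 0) := by
  rw [List.pairwise_flatMap]
  constructor
  · rintro ⟨_, h2⟩
    refine h2.imp_of_mem ?_
    intro a b ha hb hab
    exact hab _ ((encL_true a _).2 ⟨h a ha, rfl⟩) _ ((encL_true b _).2 ⟨h b hb, rfl⟩) rfl rfl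
  · intro h2
    refine ⟨fun a _ => encL_pw a, h2.imp ?_⟩
    rintro a b hab ⟨x, _⟩ hx ⟨y, _⟩ hy rfl rfl
    have := (encL_true _ _).1 hx
    have := (encL_true _ _).1 hy
    simp_all

lemma card_LL_M (n : ℕ) : (LLset n).ncard = (Mset n).ncard := by
  have : Mset n = (fun L : List (List ℕ) => L.flatMap encL) '' LLset n := by
    ext m
    constructor
    · rintro ⟨h1, h2, h3, h4⟩
      have e := enc_dec m h3
      refine ⟨decM m, ⟨dec_ne m, ?_, ?_, ?_⟩, e⟩
      · rw [← enc_map, e]; exact h1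
      · rw [← enc_map, e]; exact h2
      · rw [← enc_pw _ (dec_ne m), e]; exact h4
    · rintro ⟨L, ⟨h1, h2, h3, h4⟩, rfl⟩
      refine ⟨?_, ?_, enc_last L h1, (enc_pw L h1).2 h4⟩
      · simp only [enc_map]; exact h2
      · simp only [enc_map]; exact h3
  rw [this, Set.InjOn.ncard_image]
  intro L hL L' hL' h
  have := congrArg decM h
  simpa only [dec_enc L hL.1, dec_enc L' hL'.1] using this

lemma card_D_M (n : ℕ) (hn : 1 ≤ n) : (Dset n).ncard = (Mset n).ncard := by
  have : Mset n = (fun p : Equiv.Perm (Fin n) × (Fin n → Bool) =>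
      List.ofFn (fun i => ((p.1 i : ℕ) + 1, p.2 i))) '' Dset n := by
    ext m
    constructor
    · rintro ⟨h1, h2, h3, h4⟩
      have hlen : m.length = n := by
        have h5 : (m.map Prod.fst).toFinset = Finset.Icc 1 n := by
          ext x; rw [List.mem_toFinset, h2, Finset.mem_Icc]
        have := congrArg Finset.card h5
        rw [List.toFinset_card_of_nodup h1] at this
        simpa using this
      subst hlen
      have hb : ∀ i : Fin m.length, 1 ≤ (m.get i).1 ∧ (m.get i).1 ≤ m.length := fun i =>
        (h2 _).1 (List.mem_map_of_mem (List.get_mem m i))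
      let f : Fin m.length → Fin m.length := fun i => ⟨(m.get i).1 - 1, by have := hb i; omega⟩
      have hf : Function.Injective f := by
        intro i j hij
        have h6 : (m.get i).1 = (m.get j).1 := by
          have := congrArg Fin.val hij
          have := hb i
          have := hb j
          simp only [f] at *
          omega
        have := (List.nodup_iff_injective_get.1 h1)
          (a₁ := ⟨i, by simp⟩) (a₂ := ⟨j, by simp⟩) (by simpa using h6)
        ext
        simpa using this
      refine ⟨(Equiv.ofBijective f (Finite.injective_iff_bijective.1 hf), fun i => (m.get i).2),
        ⟨?_, ?_⟩, ?_⟩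
      · intro i hi
        apply h3
        rw [List.getLast?_eq_getElem?]
        simp [← hi]
      · intro i j hij hi hj
        have := List.pairwise_iff_get.1 h4 i j hij hi hj
        have := hb i
        have := hb j
        simp only [Equiv.ofBijective_apply, f, Fin.lt_def]
        omega
      · simp only
        conv_rhs => rw [← List.ofFn_get m]
        congr 1
        funext i
        have := hb i
        ext
        · simp only [Equiv.ofBijective_apply, f]; omega
        · rfl
    · rintro ⟨⟨a, s⟩, ⟨h1, h2⟩, rfl⟩
      refine ⟨?_, ?_, ?_, ?_⟩
      · simp only [List.map_ofFn]
        rw [List.nodup_ofFn]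
        intro i j h
        simp at h
        exact a.injective (Fin.ext h)
      · intro x
        simp only [List.map_ofFn, List.mem_ofFn, Function.comp]
        constructor
        · rintro ⟨i, rfl⟩
          have := (a i).2
          omega
        · rintro ⟨h3, h4⟩
          refine ⟨a.symm ⟨x - 1, by omega⟩, ?_⟩
          simp; omega
      · intro x hx
        rw [List.getLast?_eq_getElem?] at hx
        simp at hx
        obtain ⟨_, rfl⟩ := hx
        apply h1
        simp; omega
      · rw [List.pairwise_ofFn]
        intro i j hij hi hj
        have := h2 i j hij hi hj
        simpa using this
  rw [this, Set.InjOn.ncard_image]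
  rintro ⟨a, s⟩ _ ⟨a', s'⟩ _ h
  have h := List.ofFn_injective h
  refine Prod.ext (Equiv.ext fun i => ?_) (funext fun i => ?_)
  · have := congrFun h i
    simp at this
    exact Fin.ext this.1
  · have := congrFun h i
    simp at this
    exact this.2

lemma getLastD_mem (l : List ℕ) (h : l ≠ []) : l.getLastD 0 ∈ l := by
  rw [List.getLastD_eq_getLast?, List.getLast?_eq_some_getLast h]
  simp

lemma card_LL_P (n : ℕ) : (LLset n).ncard = pilCount n := by
  unfold pilCount
  have key : ∀ L ∈ LLset n, L.Nodup := fun L hL =>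
    hL.2.2.2.imp (fun {a b} h e => by subst e; exact lt_irrefl _ h)
  have : {P : Finset (List ℕ) | IsPIL (Finset.Icc 1 n) P} = List.toFinset '' LLset n := by
    ext P
    constructor
    · rintro ⟨h1, h2, h3⟩
      let r : List ℕ → List ℕ → Prop := fun l l' => l'.getLastD 0 ≤ l.getLastD 0
      have : Std.Total r := ⟨fun a b => le_total _ _⟩
      have : IsTrans _ r := ⟨fun a b c h h' => le_trans h' h⟩
      have hp : (P.toList.insertionSort r).Perm P.toList := List.perm_insertionSort _ _
      have hmem : ∀ l, l ∈ P.toList.insertionSort r ↔ l ∈ P := fun l => by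
        rw [hp.mem_iff, Finset.mem_toList]
      have hnd : (P.toList.insertionSort r).Nodup := hp.nodup_iff.2 P.nodup_toList
      have hs : (P.toList.insertionSort r).Pairwise r := List.pairwise_insertionSort _ _
      refine ⟨P.toList.insertionSort r, ⟨?_, ?_, ?_, ?_⟩, ?_⟩
      · intro l hl
        exact (h1 l ((hmem l).1 hl)).2
      · rw [List.nodup_flatten]
        refine ⟨fun l hl => (h1 l ((hmem l).1 hl)).1, ?_⟩
        refine List.Pairwise.imp_of_mem ?_ hnd
        intro a b ha hb hab
        exact List.disjoint_toFinset_iff_disjoint.1 (h2 a ((hmem a).1 ha) b ((hmem b).1 hb) hab)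
      · intro x
        rw [← Finset.mem_Icc, ← h3]
        simp [hmem]
      · refine List.Pairwise.imp_of_mem ?_ (hs.and hnd)
        rintro a b ha hb ⟨hr, hab⟩
        refine lt_of_le_of_ne hr ?_
        intro e
        have ha := (hmem a).1 ha
        have hb := (hmem b).1 hb
        have hd := List.disjoint_toFinset_iff_disjoint.1 (h2 a ha b hb hab)
        exact hd (getLastD_mem a (h1 a ha).2) (e ▸ getLastD_mem b (h1 b hb).2)
      · ext l
        rw [List.mem_toFinset, hmem]
    · rintro ⟨L, hL, rfl⟩
      obtain ⟨h1, h2, h3, h4⟩ := hL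
      rw [List.nodup_flatten] at h2
      refine ⟨?_, ?_, ?_⟩
      · intro l hl
        rw [List.mem_toFinset] at hl
        exact ⟨h2.1 l hl, h1 l hl⟩
      · intro l hl l' hl' hne
        rw [List.mem_toFinset] at hl hl'
        rw [List.disjoint_toFinset_iff_disjoint]
        have : Std.Symm (List.Disjoint (α := ℕ)) := ⟨fun _ _ h => h.symm⟩
        exact h2.2.forall hl hl' hne
      · ext x
        rw [Finset.mem_Icc, ← h3]
        simp
  rw [this, Set.InjOn.ncard_image]
  intro L hL L' hL' h
  have hp : L.Perm L' := List.perm_of_nodup_nodup_toFinset_eq (key L hL) (key L' hL') h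
  refine hp.eq_of_pairwise ?_ hL.2.2.2 hL'.2.2.2
  intro a b _ _ h1 h2
  exact absurd h1 (lt_asymm h2)

def Cs {n : ℕ} (a : Equiv.Perm (Fin n)) (j : Fin n) : Submodule ℂ (Fin n → ℂ) where
  carrier := {x | ∀ i, j < a i → x i = 0}
  add_mem' := by
    intro x y hx hy i hi
    simp [hx i hi, hy i hi]
  zero_mem' := by intro i _; rfl
  smul_mem' := by
    intro c x hx i hi
    simp [hx i hi]

lemma mem_Cs {n : ℕ} (a : Equiv.Perm (Fin n)) (j : Fin n) (x : Fin n → ℂ) :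
    x ∈ Cs a j ↔ ∀ i, j < a i → x i = 0 := Iff.rfl

lemma Cs_eq_span {n : ℕ} (a : Equiv.Perm (Fin n)) (j : Fin n) :
    Cs a j = Submodule.span ℂ ((Pi.basisFun ℂ (Fin n)) '' {i | a i ≤ j}) := by
  ext x
  rw [Module.Basis.mem_span_image, mem_Cs]
  constructor
  · intro h i hi
    by_contra hc
    simp at hi hc
    exact hi (h i hc)
  · intro h i hi
    by_contra hc
    have := h (a := i) (by simpa using hc)
    simp at this
    exact absurd this (not_le.2 hi)

lemma finrank_Cs {n : ℕ} (a : Equiv.Perm (Fin n)) (j : Fin n) :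
    Module.finrank ℂ (Cs a j) = (j : ℕ) + 1 := by
  have h : Cs a j = Submodule.span ℂ (Set.range
      (fun i : {i // a i ≤ j} => (Pi.basisFun ℂ (Fin n)) i)) := by
    rw [Cs_eq_span]
    congr 1
    ext x
    simp
  rw [h, finrank_span_eq_card]
  · rw [Fintype.card_congr (a.subtypeEquiv (p := fun i => a i ≤ j) (q := fun i => i ≤ j)
      (fun i => Iff.rfl))]
    rw [Fintype.card_subtype]
    have : (Finset.univ.filter (fun x : Fin n => x ≤ j)) = Finset.Iic j := by ext; simp
    rw [this, Fin.card_Iic]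
  · exact (Pi.basisFun ℂ (Fin n)).linearIndependent.comp _ Subtype.val_injective

lemma toLin_inj {n : ℕ} {u : Matrix (Fin n) (Fin n) ℂ} (hu : IsUnit u) :
    Function.Injective (Matrix.toLin' u) := by
  have := Matrix.mulVec_injective_iff_isUnit.2 hu
  intro x y h
  exact this (by simpa using h)

lemma finrank_mapU {n : ℕ} {u : Matrix (Fin n) (Fin n) ℂ} (hu : IsUnit u)
    (W : Submodule ℂ (Fin n → ℂ)) :
    Module.finrank ℂ (W.map (Matrix.toLin' u)) = Module.finrank ℂ W :=
  (Submodule.equivMapOfInjective _ (toLin_inj hu) W).finrank_eq.symm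

/-- flag attached to an invertible matrix and a permutation -/
def flagOf {n : ℕ} (u : Matrix (Fin n) (Fin n) ℂ) (hu : IsUnit u) (a : Equiv.Perm (Fin n)) :
    CompleteFlag n where
  V j := (Cs a j).map (Matrix.toLin' u)
  mono i j hij := Submodule.map_mono (fun x hx k hk => hx k (lt_of_le_of_lt hij hk))
  dimV j := by rw [finrank_mapU hu, finrank_Cs]

lemma flag_ext {n : ℕ} {F G : CompleteFlag n} (h : ∀ j, F.V j = G.V j) : F = G := by
  cases F; cases G
  congr
  exact funext h

def UT {n : ℕ} (u : Matrix (Fin n) (Fin n) ℂ) : Prop := ∀ i j : Fin n, j < i → u i j = 0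

lemma UT.mul {n : ℕ} {u v : Matrix (Fin n) (Fin n) ℂ} (hu : UT u) (hv : UT v) : UT (u * v) := by
  have h1 : Matrix.BlockTriangular u id := fun i j h => hu i j h
  have h2 : Matrix.BlockTriangular v id := fun i j h => hv i j h
  exact fun i j h => (h1.mul h2) h

lemma UT.inv {n : ℕ} {u : Matrix (Fin n) (Fin n) ℂ} (hu : UT u) (h : IsUnit u) : UT u⁻¹ := by
  have h1 : Matrix.BlockTriangular u id := fun i j h => hu i j h
  let := h.invertible
  exact fun i j h => (Matrix.blockTriangular_inv_of_blockTriangular h1) h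

lemma UT.det {n : ℕ} {u : Matrix (Fin n) (Fin n) ℂ} (hu : UT u) : u.det = ∏ i, u i i :=
  Matrix.det_of_isUpperTriangular (fun i j h => hu i j h)

lemma UT.isUnit {n : ℕ} {u : Matrix (Fin n) (Fin n) ℂ} (hu : UT u) (h : ∀ i, u i i ≠ 0) :
    IsUnit u := by
  rw [Matrix.isUnit_iff_isUnit_det, hu.det, isUnit_iff_ne_zero]
  exact Finset.prod_ne_zero_iff.2 (fun i _ => h i)

lemma UT.diag {n : ℕ} {u : Matrix (Fin n) (Fin n) ℂ} (hu : UT u) (h : IsUnit u) (i) :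
    u i i ≠ 0 := by
  rw [Matrix.isUnit_iff_isUnit_det, hu.det, isUnit_iff_ne_zero] at h
  exact Finset.prod_ne_zero_iff.1 h i (Finset.mem_univ i)

/-- memB in the form: invertible, upper triangular, fixes the last basis vector -/
lemma memB_iff {n : ℕ} (hn : 1 ≤ n) (g : Matrix (Fin n) (Fin n) ℂ) :
    memB n g ↔ IsUnit g ∧ UT g ∧
      g.mulVec (Pi.single ⟨n - 1, by omega⟩ 1) = Pi.single ⟨n - 1, by omega⟩ 1 := by
  unfold memB
  refine and_congr Iff.rfl (and_congr Iff.rfl ?_)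
  rw [Matrix.mulVec_single_one]
  constructor
  · rintro ⟨h1, h2⟩
    funext i
    by_cases hi : i = ⟨n - 1, by omega⟩
    · subst hi
      simp only [Matrix.col_apply, Pi.single_eq_same]
      exact h1 _ (by simp; omega)
    · rw [Pi.single_eq_of_ne hi]
      refine h2 _ _ (by simp; omega) ?_
      intro h
      exact hi (Fin.ext (by simp; omega))
  · intro h
    constructor
    · intro i hi
      have e : i = ⟨n - 1, by omega⟩ := Fin.ext (by simp; omega)
      have := congrFun h i
      rw [← e] at this
      simpa using this
    · intro i j hj hi
      have e : j = ⟨n - 1, by omega⟩ := Fin.ext (by simp; omega)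
      have := congrFun h i
      rw [Pi.single_eq_of_ne (by intro h; apply hi; rw [h]; simp; omega)] at this
      rw [e]
      simpa using this

lemma memB_one {n : ℕ} (hn : 1 ≤ n) : memB n 1 := by
  rw [memB_iff hn]
  refine ⟨isUnit_one, ?_, Matrix.one_mulVec _⟩
  intro i j h
  exact Matrix.one_apply_ne h.ne'

lemma memB_mul {n : ℕ} (hn : 1 ≤ n) {g h : Matrix (Fin n) (Fin n) ℂ} (hg : memB n g)
    (hh : memB n h) : memB n (g * h) := by
  rw [memB_iff hn] at *
  refine ⟨hg.1.mul hh.1, hg.2.1.mul hh.2.1, ?_⟩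
  rw [← Matrix.mulVec_mulVec, hh.2.2, hg.2.2]

lemma matInvMul {n : ℕ} {g : Matrix (Fin n) (Fin n) ℂ} (hg : IsUnit g) : g⁻¹ * g = 1 :=
  Matrix.nonsing_inv_mul g ((Matrix.isUnit_iff_isUnit_det g).1 hg)

lemma matMulInv {n : ℕ} {g : Matrix (Fin n) (Fin n) ℂ} (hg : IsUnit g) : g * g⁻¹ = 1 :=
  Matrix.mul_nonsing_inv g ((Matrix.isUnit_iff_isUnit_det g).1 hg)

lemma matUnitInv {n : ℕ} {g : Matrix (Fin n) (Fin n) ℂ} (hg : IsUnit g) : IsUnit g⁻¹ :=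
  IsUnit.of_mul_eq_one g (matInvMul hg)

lemma memB_inv {n : ℕ} (hn : 1 ≤ n) {g : Matrix (Fin n) (Fin n) ℂ} (hg : memB n g) :
    memB n g⁻¹ := by
  rw [memB_iff hn] at *
  refine ⟨matUnitInv hg.1, hg.2.1.inv hg.1, ?_⟩
  conv_lhs => rw [← hg.2.2]
  rw [Matrix.mulVec_mulVec, matInvMul hg.1, Matrix.one_mulVec]

lemma flagRel_equiv {n : ℕ} (hn : 1 ≤ n) : Equivalence (flagRel n) where
  refl F := ⟨1, memB_one hn, fun i => by simp⟩
  symm := by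
    rintro F G ⟨g, hg, h⟩
    refine ⟨g⁻¹, memB_inv hn hg, fun i => ?_⟩
    rw [← h i, ← Submodule.map_comp, ← Matrix.toLin'_mul, matInvMul hg.1]
    simp
  trans := by
    rintro F G H ⟨g, hg, h⟩ ⟨g', hg', h'⟩
    refine ⟨g * g', memB_mul hn hg hg', fun i => ?_⟩
    rw [Matrix.toLin'_mul, Submodule.map_comp, h' i]
    exact h i

/-- Every complete flag is adapted to an upper triangular basis (Bruhat). -/
lemma bruhat {n : ℕ} (F : CompleteFlag n) :
    ∃ (u : Matrix (Fin n) (Fin n) ℂ) (hu : IsUnit u) (a : Equiv.Perm (Fin n)),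
      UT u ∧ F = flagOf u hu a := by
  let Good : Fin n → (Fin n → ℂ) → Prop := fun j f => f ∈ F.V j ∧ f ≠ 0 ∧ ∀ k < j, f ∉ F.V k
  have hex : ∀ j, ∃ f, Good j f := by
    intro j
    by_cases hj : (j : ℕ) = 0
    · have h1 : F.V j ≠ ⊥ := by
        intro h
        have := F.dimV j
        rw [h, finrank_bot] at this
        omega
      obtain ⟨f, hf, h0⟩ := Submodule.exists_mem_ne_zero_of_ne_bot h1
      exact ⟨f, hf, h0, fun k hk => absurd hk (by rw [Fin.lt_def]; omega)⟩
    · let j' : Fin n := ⟨j - 1, by omega⟩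
      have h1 : ¬ F.V j ≤ F.V j' := by
        intro h
        have := Submodule.finrank_mono h
        rw [F.dimV, F.dimV] at this
        simp only [j'] at this
        omega
      obtain ⟨f, hf, h0⟩ := SetLike.not_le_iff_exists.1 h1
      refine ⟨f, hf, ?_, fun k hk hc => h0 (F.mono k j' ?_ hc)⟩
      · rintro rfl
        exact h0 (zero_mem _)
      · rw [Fin.le_def]
        rw [Fin.lt_def] at hk
        simp only [j']
        omega
  have hpf : ∀ j, ∃ (p : Fin n) (f : Fin n → ℂ), Good j f ∧ (∀ k, p < k → f k = 0) ∧ f p ≠ 0 ∧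
      ∀ f', Good j f' → ∃ k, p ≤ k ∧ f' k ≠ 0 := by
    intro j
    have hP : ∃ m : ℕ, ∃ f, Good j f ∧ ∀ k : Fin n, m ≤ k → f k = 0 := by
      obtain ⟨f, hf⟩ := hex j
      exact ⟨n, f, hf, fun k hk => absurd hk (by omega)⟩
    classical
    obtain ⟨f, hf, hz⟩ := Nat.find_spec hP
    have hmin : ∀ m < Nat.find hP, ¬ _ := fun m hm => Nat.find_min hP hm
    generalize Nat.find hP = m at hz hmin
    rcases m with _ | m
    · exact absurd (funext fun k => hz k (Nat.zero_le _)) hf.2.1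
    · have hm := hmin m (by omega)
      push Not at hm
      have hmn : m < n := by
        obtain ⟨k, hk, _⟩ := hm f hf
        omega
      refine ⟨⟨m, hmn⟩, f, hf, fun k hk => hz k hk, ?_, fun f' hf' => hm f' hf'⟩
      obtain ⟨k, hk, hk2⟩ := hm f hf
      have : k = ⟨m, hmn⟩ := by
        ext
        by_contra hne
        simp only at hne
        exact hk2 (hz k (by omega))
      rwa [← this]
  choose p f hg hz hnz hmin using hpf
  have hlt : ∀ j k, j < k → p j ≠ p k := by
    intro j k hjk hp
    let c := f k (p k) / f j (p k)
    have hnj : f j (p k) ≠ 0 := hp ▸ hnz j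
    have hout : ∀ k' < k, f k - c • f j ∉ F.V k' := by
      intro k' hk' hc
      have h1 : f k - c • f j ∈ F.V (max k' j) := F.mono _ _ (le_max_left _ _) hc
      have h2 : c • f j ∈ F.V (max k' j) :=
        Submodule.smul_mem _ _ (F.mono _ _ (le_max_right _ _) (hg j).1)
      have h3 := add_mem h1 h2
      rw [sub_add_cancel] at h3
      exact (hg k).2.2 _ (max_lt hk' hjk) h3
    have hgood : Good k (f k - c • f j) := by
      refine ⟨sub_mem (hg k).1 (Submodule.smul_mem _ _ (F.mono _ _ hjk.le (hg j).1)), ?_, hout⟩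
      intro h0
      apply hout j hjk
      rw [h0]
      exact zero_mem _
    obtain ⟨q, hq, hq2⟩ := hmin k _ hgood
    apply hq2
    rcases hq.eq_or_lt with h | h
    · subst h
      simp [c, hnj]
    · simp [hz k q h, hz j q (hp ▸ h)]
  have hinj : Function.Injective p := by
    intro j k h
    rcases lt_trichotomy j k with h' | h' | h'
    · exact absurd h (hlt _ _ h')
    · exact h'
    · exact absurd h.symm (hlt _ _ h')
  let b : Equiv.Perm (Fin n) := Equiv.ofBijective p (Finite.injective_iff_bijective.1 hinj)
  have hb : ∀ j, b j = p j := fun j => rfl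
  let u : Matrix (Fin n) (Fin n) ℂ := fun i j => f (b.symm j) i
  have hut : UT u := by
    intro i j hij
    apply hz
    rw [← hb, b.apply_symm_apply]
    exact hij
  have hu : IsUnit u := hut.isUnit (by
    intro i
    have := hnz (b.symm i)
    rwa [← hb, b.apply_symm_apply] at this)
  refine ⟨u, hu, b.symm, hut, flag_ext fun j => ?_⟩
  symm
  apply Submodule.eq_of_le_of_finrank_eq
  · change (Cs b.symm j).map _ ≤ _
    rw [Cs_eq_span, Submodule.map_span, Submodule.span_le]
    rintro _ ⟨_, ⟨i, hi, rfl⟩, rfl⟩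
    have : (Matrix.toLin' u) ((Pi.basisFun ℂ (Fin n)) i) = f (b.symm i) := by
      simp [Matrix.toLin'_apply]
      rfl
    rw [this]
    exact F.mono _ _ hi (hg _).1
  · rw [F.dimV, CompleteFlag.dimV]

/-- the normal form matrix : the last column is replaced. -/
def vS {n : ℕ} (s : Fin n → Bool) : Fin n → ℂ := fun i => if s i then 1 else 0

def lastF {n : ℕ} (hn : 1 ≤ n) : Fin n := ⟨n - 1, by omega⟩

def hS {n : ℕ} (hn : 1 ≤ n) (s : Fin n → Bool) : Matrix (Fin n) (Fin n) ℂ :=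
  fun i j => if j = lastF hn then (if i = j then 1 else - vS s i) else (if i = j then 1 else 0)

lemma le_lastF {n : ℕ} (hn : 1 ≤ n) (i : Fin n) : i ≤ lastF hn := by
  rw [Fin.le_def]; simp only [lastF]; omega

lemma hS_UT {n : ℕ} (hn : 1 ≤ n) (s : Fin n → Bool) : UT (hS hn s) := by
  intro i j hij
  have h1 : j ≠ lastF hn := (lt_of_lt_of_le hij (le_lastF hn i)).ne
  simp [hS, h1, hij.ne']

lemma hS_unit {n : ℕ} (hn : 1 ≤ n) (s : Fin n → Bool) : IsUnit (hS hn s) :=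
  (hS_UT hn s).isUnit (by intro i; simp [hS])

lemma hS_mulVec {n : ℕ} (hn : 1 ≤ n) (s : Fin n → Bool) (hs : s (lastF hn) = true) :
    (hS hn s).mulVec (vS s) = Pi.single (lastF hn) 1 := by
  funext i
  have hsl : vS s (lastF hn) = 1 := by simp [vS, hs]
  rw [Matrix.mulVec, dotProduct, ← Finset.add_sum_erase _ _ (Finset.mem_univ (lastF hn)), hsl]
  have h2 : ∑ j ∈ Finset.univ.erase (lastF hn), hS hn s i j * vS s j =
      ∑ j ∈ Finset.univ.erase (lastF hn), if i = j then vS s j else 0 := by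
    refine Finset.sum_congr rfl fun j hj => ?_
    have := Finset.ne_of_mem_erase hj
    simp [hS, this]
  rw [h2, Finset.sum_ite_eq]
  by_cases hi : i = lastF hn
  · subst hi
    simp [hS]
  · simp [hS, hi]

lemma hS_inv_mulVec {n : ℕ} (hn : 1 ≤ n) (s : Fin n → Bool) (hs : s (lastF hn) = true) :
    (hS hn s)⁻¹.mulVec (Pi.single (lastF hn) 1) = vS s := by
  rw [← hS_mulVec hn s hs, Matrix.mulVec_mulVec, matInvMul (hS_unit hn s), Matrix.one_mulVec]

lemma perm_eq_of_le {n : ℕ} (a b : Equiv.Perm (Fin n)) (h : ∀ i, a i ≤ b i) : a = b := by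
  have hs : ∑ i, (a i : ℕ) = ∑ i, (b i : ℕ) := by
    rw [Equiv.sum_comp a (fun i : Fin n => (i : ℕ)), Equiv.sum_comp b (fun i : Fin n => (i : ℕ))]
  have := (Finset.sum_eq_sum_iff_of_le (f := fun i => (a i : ℕ)) (g := fun i => (b i : ℕ))
    (fun i _ => h i)).1 hs
  exact Equiv.ext fun i => Fin.ext (this i (Finset.mem_univ i))

/-- key step for injectivity -/
lemma inj_aux {n : ℕ} (hn : 1 ≤ n) (p q : Equiv.Perm (Fin n) × (Fin n → Bool))
    (hp : p ∈ Dset n) (hq : q ∈ Dset n) (g : Matrix (Fin n) (Fin n) ℂ) (hg : memB n g)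
    (h : ∀ j, ((flagOf (hS hn p.2) (hS_unit hn p.2) p.1).V j).map (Matrix.toLin' g) =
      (flagOf (hS hn q.2) (hS_unit hn q.2) q.1).V j) :
    p.1 = q.1 ∧ ∀ i, q.2 i = true → ∃ j, p.2 j = true ∧ i ≤ j ∧ q.1 i ≤ p.1 j := by
  have hpl : p.2 (lastF hn) = true := hp.1 _ (by simp only [lastF]; omega)
  have hql : q.2 (lastF hn) = true := hq.1 _ (by simp only [lastF]; omega)
  rw [memB_iff hn] at hg
  obtain ⟨hgu, hgt, hgl⟩ := hg
  set t := (hS hn q.2)⁻¹ * (g * hS hn p.2) with ht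
  have htU : UT t := ((hS_UT hn q.2).inv (hS_unit hn q.2)).mul (hgt.mul (hS_UT hn p.2))
  have htu : IsUnit t := (matUnitInv (hS_unit hn q.2)).mul (hgu.mul (hS_unit hn p.2))
  have hC : ∀ j, (Cs p.1 j).map (Matrix.toLin' t) = Cs q.1 j := by
    intro j
    have h1 := congrArg (Submodule.map (Matrix.toLin' (hS hn q.2)⁻¹)) (h j)
    change Submodule.map _ (Submodule.map _ (Submodule.map _ _)) =
      Submodule.map _ (Submodule.map _ _) at h1
    rw [← Submodule.map_comp, ← Submodule.map_comp, ← Submodule.map_comp, ← Matrix.toLin'_mul,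
      ← Matrix.toLin'_mul, ← Matrix.toLin'_mul, matInvMul (hS_unit hn q.2), Matrix.mul_assoc,
      ← ht] at h1
    rw [h1]
    simp
  have hent : ∀ k i, t k i ≠ 0 → q.1 k ≤ p.1 i := by
    intro k i hki
    by_contra hc
    apply hki
    have h1 : (Pi.single i 1 : Fin n → ℂ) ∈ Cs p.1 (p.1 i) := by
      intro l hl
      apply Pi.single_eq_of_ne
      rintro rfl
      exact lt_irrefl _ hl
    have h2 := Submodule.mem_map_of_mem (f := Matrix.toLin' t) h1
    rw [hC] at h2
    have h3 := h2 k (not_le.1 hc)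
    rw [Matrix.toLin'_apply, Matrix.mulVec_single_one] at h3
    exact h3
  constructor
  · exact (perm_eq_of_le _ _ (fun i => hent i i (htU.diag htu i))).symm
  · intro i hi
    have hv : t.mulVec (vS p.2) = vS q.2 := by
      rw [ht, ← Matrix.mulVec_mulVec, ← Matrix.mulVec_mulVec, hS_mulVec hn _ hpl]
      have : g.mulVec (Pi.single (lastF hn) 1) = Pi.single (lastF hn) 1 := hgl
      rw [this, hS_inv_mulVec hn _ hql]
    have h1 := congrFun hv i
    have h2 : vS q.2 i ≠ 0 := by simp [vS, hi]
    rw [← h1, Matrix.mulVec, dotProduct] at h2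
    obtain ⟨j, _, hj⟩ := Finset.exists_ne_zero_of_sum_ne_zero h2
    have hj1 := left_ne_zero_of_mul hj
    have hj2 := right_ne_zero_of_mul hj
    refine ⟨j, ?_, ?_, hent _ _ hj1⟩
    · by_contra hc
      simp [vS, hc] at hj2
    · by_contra hc
      exact hj1 (htU _ _ (not_le.1 hc))

lemma sub_aux {n : ℕ} (p q : Equiv.Perm (Fin n) × (Fin n → Bool)) (hq : q ∈ Dset n)
    (h1 : ∀ i, q.2 i = true → ∃ j, p.2 j = true ∧ i ≤ j ∧ q.1 i ≤ p.1 j)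
    (h2 : ∀ i, p.2 i = true → ∃ j, q.2 j = true ∧ i ≤ j ∧ p.1 i ≤ q.1 j) (i : Fin n)
    (hi : q.2 i = true) : p.2 i = true := by
  obtain ⟨j, hj, hij, hij2⟩ := h1 i hi
  obtain ⟨k, hk, hjk, hjk2⟩ := h2 j hj
  rcases (hij.trans hjk).eq_or_lt with h | h
  · have : i = j := le_antisymm hij (h ▸ hjk)
    rwa [this]
  · exact absurd (hq.2 i k h hi hk) (not_lt.2 (hij2.trans hjk2))

def repFlag {n : ℕ} (hn : 1 ≤ n) (p : Equiv.Perm (Fin n) × (Fin n → Bool)) : CompleteFlag n :=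
  flagOf (hS hn p.2) (hS_unit hn p.2) p.1

lemma rep_inj {n : ℕ} (hn : 1 ≤ n) (p q : Equiv.Perm (Fin n) × (Fin n → Bool))
    (hp : p ∈ Dset n) (hq : q ∈ Dset n) (h : flagRel n (repFlag hn p) (repFlag hn q)) :
    p = q := by
  obtain ⟨g, hg, h'⟩ := (flagRel_equiv hn).symm h
  obtain ⟨g2, hg2, h2'⟩ := h
  obtain ⟨e1, e2⟩ := inj_aux hn p q hp hq g hg h'
  obtain ⟨f1, f2⟩ := inj_aux hn q p hq hp g2 hg2 h2'
  refine Prod.ext e1 (funext fun i => ?_)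
  rw [Bool.eq_iff_iff]
  exact ⟨sub_aux q p hp f2 e2 i, sub_aux p q hq e2 f2 i⟩

lemma rep_surj {n : ℕ} (hn : 1 ≤ n) (F : CompleteFlag n) :
    ∃ p ∈ Dset n, flagRel n F (repFlag hn p) := by
  classical
  obtain ⟨u, hu, a, hut, rfl⟩ := bruhat F
  let v : Fin n → ℂ := u⁻¹.mulVec (Pi.single (lastF hn) 1)
  have huv : u.mulVec v = Pi.single (lastF hn) 1 := by
    simp only [v]
    rw [Matrix.mulVec_mulVec, matMulInv hu, Matrix.one_mulVec]
  have hvl : v (lastF hn) ≠ 0 := by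
    have := (hut.inv hu).diag (matUnitInv hu) (lastF hn)
    simp only [v]
    rw [Matrix.mulVec_single_one]
    exact this
  -- maximal elements of the support
  let Q : Fin n → Prop := fun i => v i ≠ 0 ∧ ∀ j, v j ≠ 0 → i ≤ j → a i ≤ a j → j = i
  have hQ : ∀ i, v i ≠ 0 → ∃ j, Q j ∧ i ≤ j ∧ a i ≤ a j := by
    intro i hi
    induction hk : n - (i : ℕ) using Nat.strong_induction_on generalizing i with
    | _ k ih =>
      by_cases hQi : Q i
      · exact ⟨i, hQi, le_rfl, le_rfl⟩
      · have : ∃ j, v j ≠ 0 ∧ i ≤ j ∧ a i ≤ a j ∧ j ≠ i := by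
          by_contra hc
          push Not at hc
          exact hQi ⟨hi, hc⟩
        obtain ⟨j, hj, hij, haij, hne⟩ := this
        have hlt : (i : ℕ) < j := Fin.lt_def.1 (lt_of_le_of_ne hij (Ne.symm hne))
        obtain ⟨l, hl, h1, h2⟩ := ih (n - j) (by omega) j hj rfl
        exact ⟨l, hl, hij.trans h1, haij.trans h2⟩
  have hφ : ∀ i, ∃ j, v i ≠ 0 → Q j ∧ i ≤ j ∧ a i ≤ a j := by
    intro i
    by_cases hi : v i = 0
    · exact ⟨i, fun h => absurd hi h⟩
    · obtain ⟨j, hj⟩ := hQ i hi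
      exact ⟨j, fun _ => hj⟩
  choose φ hφ using hφ
  have hφQ : ∀ i, Q i → φ i = i := by
    intro i hi
    obtain ⟨h1, h2, h3⟩ := hφ i hi.1
    exact hi.2 _ h1.1 h2 h3
  let s : Fin n → Bool := fun i => decide (Q i)
  have hs : ∀ i, s i = true ↔ Q i := fun i => by simp [s]
  have hD : (a, s) ∈ Dset n := by
    constructor
    · intro i hi
      have : i = lastF hn := Fin.ext (by simp only [lastF]; omega)
      subst this
      rw [hs]
      exact ⟨hvl, fun j _ hj _ => le_antisymm (le_lastF hn j) hj⟩
    · intro i j hij hi hj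
      rw [hs] at hi hj
      by_contra hc
      exact hij.ne' (hi.2 j hj.1 hij.le (not_lt.1 hc))
  have hsl : s (lastF hn) = true := hD.1 _ (by simp only [lastF]; omega)
  let t : Matrix (Fin n) (Fin n) ℂ := fun i j =>
    if Q j then (if φ i = j then v i else 0) else (if i = j then 1 else 0)
  have htent : ∀ i j, t i j ≠ 0 → i ≤ j ∧ a i ≤ a j := by
    intro i j hij
    simp only [t] at hij
    split_ifs at hij with h1 h2 h2
    · subst h2
      exact (hφ i hij).2
    · exact absurd rfl hij
    · subst h2
      exact ⟨le_rfl, le_rfl⟩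
    · exact absurd rfl hij
  have htU : UT t := by
    intro i j hij
    by_contra hc
    exact absurd (htent i j hc).1 (not_le.2 hij)
  have htu : IsUnit t := htU.isUnit (by
    intro i
    by_cases hi : Q i
    · simp [t, hi, hφQ i hi, hi.1]
    · simp [t, hi])
  have htv : t.mulVec (vS s) = v := by
    funext i
    have : ∀ j, t i j * vS s j = if φ i = j then (if Q j then v i else 0) else 0 := by
      intro j
      by_cases hj : Q j
      · simp [t, vS, s, hj]
      · simp [t, vS, s, hj]
    rw [Matrix.mulVec, dotProduct, Finset.sum_congr rfl (fun j _ => this j), Finset.sum_ite_eq]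
    simp only [Finset.mem_univ, if_true]
    by_cases hi : v i = 0
    · simp [hi]
    · rw [if_pos (hφ i hi).1]
  have htC : ∀ j, (Cs a j).map (Matrix.toLin' t) = Cs a j := by
    intro j
    apply Submodule.eq_of_le_of_finrank_eq
    · rintro _ ⟨x, hx, rfl⟩
      intro i hi
      rw [Matrix.toLin'_apply, Matrix.mulVec, dotProduct]
      refine Finset.sum_eq_zero fun k _ => ?_
      by_cases hk : t i k = 0
      · simp [hk]
      · rw [hx k (lt_of_lt_of_le hi (htent i k hk).2), mul_zero]
    · rw [finrank_mapU htu]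
  refine ⟨(a, s), hD, u * t * (hS hn s)⁻¹, ?_, ?_⟩
  · rw [memB_iff hn]
    refine ⟨(hu.mul htu).mul (matUnitInv (hS_unit hn s)),
      (hut.mul htU).mul ((hS_UT hn s).inv (hS_unit hn s)), ?_⟩
    change Matrix.mulVec _ (Pi.single (lastF hn) 1) = Pi.single (lastF hn) 1
    rw [← Matrix.mulVec_mulVec, hS_inv_mulVec hn s hsl, ← Matrix.mulVec_mulVec, htv, huv]
  · intro j
    change Submodule.map _ (Submodule.map _ _) = Submodule.map _ _
    rw [← Submodule.map_comp, ← Matrix.toLin'_mul, Matrix.mul_assoc, matInvMul (hS_unit hn s),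
      Matrix.mul_one, Matrix.toLin'_mul, Submodule.map_comp]
    change Submodule.map _ (Submodule.map _ (Cs a j)) = Submodule.map _ (Cs a j)
    rw [htC]

/-- The number of `B_{n-1}`-orbits on the set of complete flags in `ℂⁿ`
equals `|PIL(n)|`. -/
theorem statement0 (n : ℕ) (hn : 1 ≤ n) :
    Nat.card (Quot (flagRel n)) = pilCount n := by
  rw [← card_LL_P, card_LL_M, ← card_D_M n hn, ← Nat.card_coe_set_eq]
  symm
  refine Nat.card_eq_of_bijective
    (fun p : Dset n => Quot.mk (flagRel n) (repFlag hn p.1)) ⟨?_, ?_⟩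
  · intro p q h
    have h1 := Quot.eqvGen_exact h
    rw [(flagRel_equiv hn).eqvGen_iff] at h1
    exact Subtype.ext (rep_inj hn p.1 q.1 p.2 q.2 h1)
  · intro x
    induction x using Quot.ind with
    | mk F =>
      obtain ⟨p, hp, h⟩ := rep_surj hn F
      exact ⟨⟨p, hp⟩, (Quot.sound h).symm⟩

end
end

section
/- Let ℓ ≥ 1. The number of orbits of the group B_{SO(2ℓ−1)} acting on the set of isotropic flags of type D in ℂ^{2ℓ} equals |SPIL(ℓ)|; that is, the cardinality of the quotient of the set of such flags by the B_{SO(2ℓ−1)}-orbit equivalence relation equals the number of signed partitions into lists of {1,…,ℓ}. -/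
open scoped BigOperators

noncomputable section

/-- A signed list on the finite set `A` of positive integers: a nonempty finite sequence of
nonzero integers whose absolute values are pairwise distinct and lie in `A`, and whose last
entry is positive. -/
def IsSignedList (A : Finset ℕ) (l : List ℤ) : Prop :=
  l ≠ [] ∧ (∀ x ∈ l, x ≠ 0 ∧ x.natAbs ∈ A) ∧ (l.map Int.natAbs).Nodup ∧
    0 < l.getLastD 0

/-- `P` is a signed partition into lists (SPIL) of the finite set `A` of positive integers. -/
def IsSPIL (A : Finset ℕ) (P : Finset (List ℤ)) : Prop :=
  (∀ l ∈ P, IsSignedList A l) ∧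
  (∀ l ∈ P, ∀ l' ∈ P, l ≠ l' →
    Disjoint (l.map Int.natAbs).toFinset (l'.map Int.natAbs).toFinset) ∧
  P.biUnion (fun l => (l.map Int.natAbs).toFinset) = A

/-- `|SPIL(ℓ)|`: the number of signed partitions into lists of `{1, …, ℓ}`. -/
def spilCount (ℓ : ℕ) : ℕ := Set.ncard {P : Finset (List ℤ) | IsSPIL (Finset.Icc 1 ℓ) P}

/-- The symmetric bilinear form `β(x, y) = xᵀ S y` on `ℂⁿ`, where `S` is the permutation
matrix sending `eᵢ` to `e_{n+1-i}`. -/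
def bform (n : ℕ) (x y : Fin n → ℂ) : ℂ :=
  ∑ i : Fin n, x i * y (⟨n - 1 - (i : ℕ), by have := i.isLt; omega⟩ : Fin n)

/-- Membership in `SO(n) = {g ∈ SL(n, ℂ) : β(gx, gy) = β(x, y)}`. -/
def memSO (n : ℕ) (g : Matrix (Fin n) (Fin n) ℂ) : Prop :=
  g.det = 1 ∧ ∀ x y : Fin n → ℂ, bform n (g.mulVec x) (g.mulVec y) = bform n x y

/-- Membership in the subgroup `B_{SO(2ℓ-1)}` of `SO(2ℓ)`: upper triangular elements of
`SO(2ℓ)` fixing `e_ℓ - e_{ℓ+1}` (0-indexed: indices `ℓ - 1` and `ℓ`). -/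
def memBD (ℓ : ℕ) (hl : 1 ≤ ℓ) (g : Matrix (Fin (2 * ℓ)) (Fin (2 * ℓ)) ℂ) : Prop :=
  memSO (2 * ℓ) g ∧
  (∀ i j : Fin (2 * ℓ), (j : ℕ) < (i : ℕ) → g i j = 0) ∧
  g.mulVec ((Pi.single (⟨ℓ - 1, by omega⟩ : Fin (2 * ℓ)) 1 :
        Fin (2 * ℓ) → ℂ) - Pi.single (⟨ℓ, by omega⟩ : Fin (2 * ℓ)) 1) =
    (Pi.single (⟨ℓ - 1, by omega⟩ : Fin (2 * ℓ)) 1 : Fin (2 * ℓ) → ℂ) -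
      Pi.single (⟨ℓ, by omega⟩ : Fin (2 * ℓ)) 1

/-- An isotropic flag of type D in `ℂ^{2ℓ}`: a chain `V₁ ⊂ ⋯ ⊂ V_{ℓ-1}` of isotropic
subspaces with `dim Vᵢ = i`. -/
structure FlagD (ℓ : ℕ) where
  V : Fin (ℓ - 1) → Submodule ℂ (Fin (2 * ℓ) → ℂ)
  mono : ∀ i j, i ≤ j → V i ≤ V j
  dimV : ∀ i, Module.finrank ℂ (V i) = (i : ℕ) + 1
  isot : ∀ i, ∀ u ∈ V i, ∀ w ∈ V i, bform (2 * ℓ) u w = 0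

/-- Two isotropic flags of type D lie in the same `B_{SO(2ℓ-1)}`-orbit. -/
def flagDRel (ℓ : ℕ) (hl : 1 ≤ ℓ) (F F' : FlagD ℓ) : Prop :=
  ∃ g, memBD ℓ hl g ∧ ∀ i, (F'.V i).map (Matrix.toLin' g) = F.V i

lemma bform_eq (n : ℕ) (x y : Fin n → ℂ) : bform n x y = ∑ i : Fin n, x i * y i.rev := by
  unfold bform
  refine Finset.sum_congr rfl fun i _ => ?_
  congr 2
  ext
  simp [Fin.val_rev]
  omega

/-- The form as a bilinear map. -/
def bl (n : ℕ) : (Fin n → ℂ) →ₗ[ℂ] (Fin n → ℂ) →ₗ[ℂ] ℂ :=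
  LinearMap.mk₂ ℂ (fun x y => ∑ i : Fin n, x i * y i.rev)
    (by intro a b c; simp [add_mul, Finset.sum_add_distrib])
    (by intro a b c; simp [Finset.mul_sum, mul_assoc])
    (by intro a b c; simp [mul_add, Finset.sum_add_distrib])
    (by intro a b c; simp [Finset.mul_sum, mul_left_comm])

lemma bl_apply (n : ℕ) (x y : Fin n → ℂ) : bl n x y = ∑ i : Fin n, x i * y i.rev := rfl

lemma bform_bl (n : ℕ) (x y : Fin n → ℂ) : bform n x y = bl n x y := bform_eq n x y

lemma bl_symm (n : ℕ) (x y : Fin n → ℂ) : bl n x y = bl n y x := by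
  rw [bl_apply, bl_apply]
  rw [← Equiv.sum_comp Fin.revPerm]
  refine Finset.sum_congr rfl fun i _ => ?_
  simp [mul_comm]

/-- Hyperbolic frames adapted to the standard flag. -/
structure Fr (n : ℕ) (f : Fin n → Fin n → ℂ) : Prop where
  orth : ∀ i j, bl n (f i) (f j) = if j = i.rev then 1 else 0
  upper : ∀ i k, i < k → f i k = 0

lemma bl_tri {n : ℕ} (x y : Fin n → ℂ) (i : Fin n) (hx : ∀ k, i < k → x k = 0)
    (hy : ∀ k, i.rev < k → y k = 0) : bl n x y = x i * y i.rev := by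
  rw [bl_apply]
  refine Finset.sum_eq_single i ?_ (by simp)
  intro k _ hk
  rcases lt_or_gt_of_ne hk with h | h
  · rw [hy k.rev (Fin.rev_lt_rev.mpr h), mul_zero]
  · rw [hx k h, zero_mul]

lemma Fr.diag {n : ℕ} {f : Fin n → Fin n → ℂ} (h : Fr n f) (i : Fin n) :
    f i i * f i.rev i.rev = 1 := by
  rw [← bl_tri (f i) (f i.rev) i (h.upper i) (h.upper i.rev), h.orth]; simp

lemma Fr.diag_ne {n : ℕ} {f : Fin n → Fin n → ℂ} (h : Fr n f) (i : Fin n) :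
    f i i ≠ 0 := left_ne_zero_of_mul_eq_one (h.diag i)

lemma Fr.sum_coef {n : ℕ} {f : Fin n → Fin n → ℂ} (h : Fr n f) (c : Fin n → ℂ) (i : Fin n) :
    bl n (∑ j, c j • f j) (f i.rev) = c i := by
  simp only [map_sum, map_smul, LinearMap.sum_apply, LinearMap.smul_apply, h.orth, smul_eq_mul]
  rw [Finset.sum_eq_single i]
  · simp
  · intro j _ hj
    rw [if_neg (fun e => hj (Fin.rev_injective e).symm), mul_zero]
  · simp

lemma Fr.li {n : ℕ} {f : Fin n → Fin n → ℂ} (h : Fr n f) : LinearIndependent ℂ f := by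
  rw [Fintype.linearIndependent_iff]
  intro c hc i
  rw [← h.sum_coef c i, hc]; simp

lemma Fr.expand {n : ℕ} {f : Fin n → Fin n → ℂ} (h : Fr n f) (x : Fin n → ℂ) :
    x = ∑ i, bl n x (f i.rev) • f i := by
  have hs : Submodule.span ℂ (Set.range f) = ⊤ :=
    h.li.span_eq_top_of_card_eq_finrank' (by simp)
  have hx : x ∈ Submodule.span ℂ (Set.range f) := by rw [hs]; trivial
  obtain ⟨c, rfl⟩ := (Submodule.mem_span_range_iff_exists_fun ℂ).1 hx
  simp only [h.sum_coef]

lemma Fr.coef_zero {n : ℕ} {f : Fin n → Fin n → ℂ} (h : Fr n f) (x : Fin n → ℂ) (m : Fin n)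
    (hx : ∀ k, m < k → x k = 0) (i : Fin n) (hi : m < i) : bl n x (f i.rev) = 0 := by
  rw [bl_apply]
  refine Finset.sum_eq_zero fun k _ => ?_
  rcases lt_or_ge m k with hk | hk
  · rw [hx k hk, zero_mul]
  · rw [h.upper i.rev k.rev (Fin.rev_lt_rev.mpr (lt_of_le_of_lt hk hi)), mul_zero]

lemma Fr.span_coef {n : ℕ} {f : Fin n → Fin n → ℂ} (h : Fr n f) (I : Set (Fin n)) (x : Fin n → ℂ)
    (hx : x ∈ Submodule.span ℂ (f '' I)) (i : Fin n) (hi : i ∉ I) : bl n x (f i.rev) = 0 := by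
  induction hx using Submodule.span_induction with
  | mem y hy =>
    obtain ⟨j, hj, rfl⟩ := hy
    rw [h.orth, if_neg]
    intro e
    exact hi ((Fin.rev_injective e) ▸ hj)
  | zero => simp
  | add a b _ _ ha hb => simp [ha, hb]
  | smul c a _ ha => simp [ha]

lemma Fr.mem_span {n : ℕ} {f : Fin n → Fin n → ℂ} (h : Fr n f) (I : Set (Fin n)) (x : Fin n → ℂ)
    (hx : ∀ i, i ∉ I → bl n x (f i.rev) = 0) : x ∈ Submodule.span ℂ (f '' I) := by
  rw [h.expand x]
  refine Submodule.sum_mem _ fun i _ => ?_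
  by_cases hi : i ∈ I
  · exact Submodule.smul_mem _ _ (Submodule.subset_span ⟨i, hi, rfl⟩)
  · rw [hx i hi, zero_smul]; exact Submodule.zero_mem _

lemma Fr.finrank {n : ℕ} {f : Fin n → Fin n → ℂ} (h : Fr n f) (I : Finset (Fin n)) :
    Module.finrank ℂ (Submodule.span ℂ (f '' (I : Set (Fin n)))) = I.card := by
  classical
  have := finrank_span_finset_eq_card (R := ℂ) (s := I.image f) (by
    rw [Finset.coe_image]
    exact (h.li.linearIndepOn (I : Set (Fin n))).id_image)
  rw [Finset.coe_image, Finset.card_image_of_injective _ h.li.injective] at this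
  exact this

lemma Fr.parseval {n : ℕ} {f : Fin n → Fin n → ℂ} (h : Fr n f) (x y : Fin n → ℂ) :
    bl n x y = ∑ i, bl n x (f i.rev) * bl n y (f i) := by
  conv_lhs => rw [h.expand x]
  simp only [map_sum, map_smul, LinearMap.sum_apply, LinearMap.smul_apply, smul_eq_mul]
  exact Finset.sum_congr rfl fun i _ => by rw [bl_symm n (f i) y]

/-- Eichler transformation of a frame. -/
def eich {n : ℕ} (f : Fin n → Fin n → ℂ) (m : Fin n) (x : Fin n → ℂ) (i : Fin n) : Fin n → ℂ :=
  if i = m then x else if i = m.rev then f m.rev else f i - bl n (f i) x • f m.rev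

lemma Fr.eich {n : ℕ} {f : Fin n → Fin n → ℂ} (h : Fr n f) (m : Fin n) (x : Fin n → ℂ)
    (hm : m ≠ m.rev) (hxx : bl n x x = 0) (hxm : bl n x (f m.rev) = 1)
    (hxz : ∀ i, m < i → bl n x (f i.rev) = 0) : Fr n (eich f m x) := by
  have key : ∀ i, i ≠ m → i ≠ m.rev → bl n (f i) (f m.rev) = 0 := by
    intro i h1 h2
    rw [h.orth, if_neg]
    intro e; exact h1 (Fin.rev_injective e).symm
  have hmm : bl n (f m.rev) (f m.rev) = 0 := by
    rw [h.orth, if_neg]; simpa using hm.symm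
  have hmx : bl n (f m.rev) x = 1 := by rw [bl_symm, hxm]
  have hB : ∀ i, i ≠ m → i ≠ m.rev → bl n (f m.rev) (f i) = 0 := by
    intro i h1 h2; rw [bl_symm, key i h1 h2]
  constructor
  · intro i j
    unfold _root_.eich
    by_cases hi : i = m
    · subst hi
      by_cases hj : j = i
      · subst hj; simp [hxx, hm]
      · by_cases hj' : j = i.rev
        · subst hj'; simp [hj, hxm]
        · simp [hj, hj', bl_symm n x, hmx]
    · by_cases hi' : i = m.rev
      · subst hi'
        by_cases hj : j = m
        · subst hj; simp [hi, hmx]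
        · by_cases hj' : j = m.rev
          · subst hj'; simp [hi, hmm]
          · simp [hj, hj', hi, hmm, hB j hj hj']
      · by_cases hj : j = m
        · subst hj
          have : j ≠ i.rev := fun e => hi' (by rw [e, Fin.rev_rev])
          simp [hi, hi', hmx, this]
        · by_cases hj' : j = m.rev
          · subst hj'
            have : m.rev ≠ i.rev := fun e => hi (Fin.rev_injective e).symm
            simp [hi, hi', hmm, hj, key i hi hi', this]
          · simp [hi, hi', hj, hj', hmm, key i hi hi', hB j hj hj', h.orth i j]
  · intro i k hik
    unfold _root_.eich
    by_cases hi : i = m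
    · subst hi
      simp only [if_true]
      rw [h.expand x, Finset.sum_apply]
      refine Finset.sum_eq_zero fun j _ => ?_
      rcases lt_or_ge i j with hj | hj
      · simp [hxz j hj]
      · simp [h.upper j k (lt_of_le_of_lt hj hik)]
    · by_cases hi' : i = m.rev
      · subst hi'
        simp [hi, h.upper _ k hik]
      · simp only [hi, hi', if_false, Pi.sub_apply, Pi.smul_apply, h.upper i k hik, smul_eq_mul,
          zero_sub, neg_eq_zero, mul_eq_zero]
        rcases lt_or_ge m i.rev with hj | hj
        · left
          rw [bl_symm]
          have := hxz _ hj
          rwa [Fin.rev_rev] at this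
        · right
          refine h.upper _ _ (lt_of_le_of_lt ?_ hik)
          rw [← Fin.rev_rev i]; exact Fin.rev_le_rev.mpr hj

/-- The vector `e_ℓ - e_{ℓ+1}`. -/
def vD (ℓ : ℕ) (hl : 1 ≤ ℓ) : Fin (2 * ℓ) → ℂ :=
  (Pi.single (⟨ℓ - 1, by omega⟩ : Fin (2 * ℓ)) 1 : Fin (2 * ℓ) → ℂ) -
      Pi.single (⟨ℓ, by omega⟩ : Fin (2 * ℓ)) 1

/-- The indices visited by `w` up to time `k`. -/
def Wf {ℓ : ℕ} (w : Fin ℓ → Fin (2 * ℓ)) (k : ℕ) : Finset (Fin (2 * ℓ)) :=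
  (Finset.univ.filter (fun j : Fin ℓ => j.val ≤ k)).image w

lemma mem_Wf {ℓ : ℕ} (w : Fin ℓ → Fin (2 * ℓ)) (k : ℕ) (i : Fin (2 * ℓ)) :
    i ∈ Wf w k ↔ ∃ j : Fin ℓ, j.val ≤ k ∧ w j = i := by
  simp [Wf]

lemma card_Wf {ℓ : ℕ} (w : Fin ℓ → Fin (2 * ℓ)) (k : ℕ) (hk : k < ℓ)
    (hw : ∀ a b : Fin ℓ, a.val ≤ k → b.val ≤ k → w a = w b → a = b) : (Wf w k).card = k + 1 := by
  unfold Wf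
  rw [Finset.card_image_of_injOn]
  · have : (Finset.univ.filter (fun j : Fin ℓ => j.val ≤ k)) = Finset.Iic (⟨k, hk⟩ : Fin ℓ) := by
      ext j; simp [Fin.le_def]
    rw [this, Fin.card_Iic]
  · intro a ha b hb hab
    simp at ha hb
    exact hw a b ha hb hab

/-- Combinatorial types of orbits. -/
structure IsT2 (ℓ : ℕ) (w : Fin ℓ → Fin (2 * ℓ)) (S : Finset (Fin (2 * ℓ))) : Prop where
  inj : ∀ a b, w a = w b → a = b
  rv : ∀ a b, w a ≠ (w b).rev
  last : ∀ a : Fin ℓ, a.val = ℓ - 1 → (w a).val < ℓ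
  Slt : ∀ i ∈ S, i.val + 1 < ℓ
  Sex : ∀ i ∈ S, ∃ a, w a = i.rev
  Sord : ∀ a b j, a < b → j ∈ S → w b = j.rev →
    (w a).val ≠ ℓ - 1 ∧ (w a).val ≠ ℓ ∧ ∀ i ∈ S, w a = i.rev → i < j

/-- The flag `F` has type `(w, S)`. -/
def HasType (ℓ : ℕ) (hl : 1 ≤ ℓ) (F : FlagD ℓ) (w : Fin ℓ → Fin (2 * ℓ))
    (S : Finset (Fin (2 * ℓ))) : Prop :=
  ∃ f, Fr (2 * ℓ) f ∧
    (∀ k : Fin (ℓ - 1), F.V k = Submodule.span ℂ (f '' (Wf w k : Set (Fin (2 * ℓ))))) ∧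
    ∀ l : Fin (2 * ℓ), bl (2 * ℓ) (vD ℓ hl) (f l.rev) =
      if l ∈ S ∨ l.val = ℓ - 1 then 1 else if l.val = ℓ then -1 else 0

lemma rev_ne (ℓ : ℕ) (i : Fin (2 * ℓ)) : i ≠ i.rev := by
  intro h
  have := congrArg Fin.val h
  rw [Fin.val_rev] at this
  omega

lemma HasType.rel {ℓ : ℕ} {hl : 1 ≤ ℓ} {F F' : FlagD ℓ} {w : Fin ℓ → Fin (2 * ℓ)}
    {S : Finset (Fin (2 * ℓ))} (h : HasType ℓ hl F w S) (h' : HasType ℓ hl F' w S) :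
    flagDRel ℓ hl F F' := by
  obtain ⟨f, hf, hV, hc⟩ := h
  obtain ⟨f', hf', hV', hc'⟩ := h'
  let φ : (Fin (2 * ℓ) → ℂ) →ₗ[ℂ] (Fin (2 * ℓ) → ℂ) :=
    ∑ i, (LinearMap.smulRight ((bl (2 * ℓ)).flip (f' i.rev)) (f i))
  have hφ : ∀ x, φ x = ∑ i, bl (2 * ℓ) x (f' i.rev) • f i := by
    intro x; simp [φ]
  have hφf : ∀ j, φ (f' j) = f j := by
    intro j
    rw [hφ, Finset.sum_eq_single j]
    · rw [hf'.orth]; simp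
    · intro i _ hi
      rw [hf'.orth, if_neg (fun e => hi (Fin.rev_injective e)), zero_smul]
    · simp
  have hφB : ∀ x y, bl (2 * ℓ) (φ x) (φ y) = bl (2 * ℓ) x y := by
    intro x y
    rw [hf.parseval, hf'.parseval x y]
    refine Finset.sum_congr rfl fun i _ => ?_
    rw [hφ x, hφ y, hf.sum_coef]
    have := hf.sum_coef (fun i => bl (2 * ℓ) y (f' i.rev)) i.rev
    rw [Fin.rev_rev] at this
    rw [this]
  have hφv : φ (vD ℓ hl) = vD ℓ hl := by
    rw [hφ]
    conv_rhs => rw [hf.expand (vD ℓ hl)]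
    refine Finset.sum_congr rfl fun i _ => ?_
    rw [hc, hc']
  have hmul : ∀ x, (LinearMap.toMatrix' φ).mulVec x = φ x := by
    intro x
    rw [← Matrix.toLin'_apply, Matrix.toLin'_toMatrix']
  have hup : ∀ i j : Fin (2 * ℓ), j < i → LinearMap.toMatrix' φ i j = 0 := by
    intro i j hji
    rw [LinearMap.toMatrix'_apply]
    rw [hφ, Finset.sum_apply]
    refine Finset.sum_eq_zero fun k _ => ?_
    rcases lt_or_ge j k with hk | hk
    · rw [hf'.coef_zero _ j _ k hk]; simp
      intro l hl
      rw [Pi.single_apply, if_neg (ne_of_gt hl)]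
    · simp [hf.upper k i (lt_of_le_of_lt hk hji)]
  refine ⟨LinearMap.toMatrix' φ, ⟨⟨?_, ?_⟩, ?_, ?_⟩, ?_⟩
  · rw [Matrix.det_of_isUpperTriangular (fun i j hij => hup i j hij)]
    have hd : ∀ i : Fin (2 * ℓ), LinearMap.toMatrix' φ i i = f i i * f' i.rev i.rev := by
      intro i
      rw [LinearMap.toMatrix'_apply, hφ, Finset.sum_apply, Finset.sum_eq_single i]
      · rw [bl_tri _ (f' i.rev) i _ (hf'.upper _)]
        · simp [mul_comm]
        · intro k hk; rw [Pi.single_apply, if_neg (ne_of_gt hk)]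
      · intro k _ hki
        rcases lt_or_gt_of_ne hki with hk | hk
        · simp [hf.upper k i hk]
        · rw [hf'.coef_zero _ i _ k hk]; simp
          intro l hl
          rw [Pi.single_apply, if_neg (ne_of_gt hl)]
      · simp
    refine Finset.prod_involution (fun i _ => i.rev) ?_ ?_ ?_ ?_
    · intro i _
      rw [hd, hd, Fin.rev_rev]
      have h1 := hf.diag i
      have h2 := hf'.diag i
      linear_combination (f' i.rev i.rev * f' i i) * h1 + h2
    · intro i _ _; exact (rev_ne ℓ i).symm
    · simp
    · simp
  · intro x y
    rw [bform_bl, bform_bl, hmul, hmul, hφB]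
  · intro i j hij; exact hup i j hij
  · exact (hmul _).trans hφv
  · intro i
    rw [hV', hV, Matrix.toLin'_toMatrix', Submodule.map_span, Set.image_image]
    simp only [hφf]

lemma HasType.of_rel {ℓ : ℕ} {hl : 1 ≤ ℓ} {F F' : FlagD ℓ} {w : Fin ℓ → Fin (2 * ℓ)}
    {S : Finset (Fin (2 * ℓ))} (h : flagDRel ℓ hl F F') (h' : HasType ℓ hl F' w S) :
    HasType ℓ hl F w S := by
  obtain ⟨f', hf', hV', hc'⟩ := h'
  obtain ⟨g, ⟨⟨hdet, hB⟩, hup, hv⟩, hV⟩ := h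
  refine ⟨fun i => g.mulVec (f' i), ⟨?_, ?_⟩, ?_, ?_⟩
  · intro i j
    rw [← bform_bl, hB, bform_bl, hf'.orth]
  · intro i k hik
    simp only [Matrix.mulVec, dotProduct]
    refine Finset.sum_eq_zero fun j _ => ?_
    rcases lt_or_ge i j with hj | hj
    · rw [hf'.upper i j hj, mul_zero]
    · rw [hup k j (lt_of_le_of_lt hj hik), zero_mul]
  · intro k
    rw [← hV, hV', Submodule.map_span, Set.image_image]
    rfl
  · intro l
    rw [← hc']
    have : vD ℓ hl = g.mulVec (vD ℓ hl) := hv.symm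
    conv_lhs => rw [this]
    rw [← bform_bl, hB, bform_bl]

lemma std_Fr (n : ℕ) : Fr n (fun i => Pi.single i 1) := by
  constructor
  · intro i j
    rw [bl_apply, Finset.sum_eq_single i]
    · simp [Pi.single_apply, eq_comm]
    · intro k _ hk; simp [hk]
    · simp
  · intro i k h
    rw [Pi.single_apply, if_neg (ne_of_gt h)]

lemma bl_vD (ℓ : ℕ) (hl : 1 ≤ ℓ) (y : Fin (2 * ℓ) → ℂ) :
    bl (2 * ℓ) (vD ℓ hl) y = y ⟨ℓ, by omega⟩ - y ⟨ℓ - 1, by omega⟩ := by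
  have e1 : (⟨ℓ - 1, by omega⟩ : Fin (2 * ℓ)).rev = ⟨ℓ, by omega⟩ := by
    ext; rw [Fin.val_rev]; simp; omega
  have e2 : (⟨ℓ, by omega⟩ : Fin (2 * ℓ)).rev = ⟨ℓ - 1, by omega⟩ := by
    ext; rw [Fin.val_rev]; simp; omega
  simp only [bl_apply, vD, Pi.sub_apply, sub_mul, Finset.sum_sub_distrib, Pi.single_apply, ite_mul,
    one_mul, zero_mul, Finset.sum_ite_eq', Finset.mem_univ, if_true, e1, e2]

lemma exists_flag (ℓ : ℕ) (hl : 1 ≤ ℓ) (w : Fin ℓ → Fin (2 * ℓ)) (S : Finset (Fin (2 * ℓ)))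
    (hT : IsT2 ℓ w S) : ∃ F, HasType ℓ hl F w S := by
  classical
  -- the frame
  let m : Fin (2 * ℓ) := ⟨ℓ - 1, by omega⟩
  have hmr : m.rev = ⟨ℓ, by omega⟩ := by
    ext; rw [Fin.val_rev]; simp [m]; omega
  let e : Fin (2 * ℓ) → Fin (2 * ℓ) → ℂ := fun i => Pi.single i 1
  let x : Fin (2 * ℓ) → ℂ := fun i => if i = m then 1 else if i ∈ S then -1 else 0
  have hxz : ∀ k, m < k → x k = 0 := by
    intro k hk
    have h1 : k ≠ m := ne_of_gt hk
    have h2 : k ∉ S := fun h => by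
      have := hT.Slt k h
      have hk' : ℓ - 1 < k.val := hk
      omega
    simp [x, h1, h2]
  have he := std_Fr (2 * ℓ)
  have hble : ∀ y i, bl (2 * ℓ) y (e i) = y i.rev := by
    intro y i
    rw [bl_apply, Finset.sum_eq_single i.rev]
    · simp [e]
    · intro k _ hk
      have : k.rev ≠ i := fun h => hk (by rw [← h, Fin.rev_rev])
      simp [e, this]
    · simp
  have hf : Fr (2 * ℓ) (eich e m x) := by
    refine he.eich m x (rev_ne ℓ m) ?_ ?_ ?_
    · rw [bl_apply]
      refine Finset.sum_eq_zero fun i _ => ?_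
      rcases lt_or_ge m i with h | h
      · rw [hxz i h, zero_mul]
      · rw [hxz i.rev, mul_zero]
        have : i.val ≤ ℓ - 1 := h
        rw [Fin.lt_def, Fin.val_rev]
        simp [m]; omega
    · rw [hble]; simp [x]
    · intro i hi; rw [hble, Fin.rev_rev, hxz i hi]
  have hsp : ∀ k : Fin (ℓ - 1), ∀ u ∈ Submodule.span ℂ (eich e m x '' (Wf w k : Set (Fin (2 * ℓ)))),
      ∀ u' ∈ Submodule.span ℂ (eich e m x '' (Wf w k : Set (Fin (2 * ℓ)))),
      bform (2 * ℓ) u u' = 0 := by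
    intro k u hu u' hu'
    rw [bform_bl, hf.parseval]
    refine Finset.sum_eq_zero fun i _ => ?_
    by_cases hi : i ∈ Wf w k
    · have : i.rev ∉ Wf w k := by
        intro hi'
        rw [mem_Wf] at hi hi'
        obtain ⟨a, _, ha⟩ := hi
        obtain ⟨b, _, hb⟩ := hi'
        exact hT.rv b a (by rw [ha, hb])
      have h2 := hf.span_coef _ _ hu' i.rev this
      rw [Fin.rev_rev] at h2
      rw [h2, mul_zero]
    · rw [hf.span_coef _ _ hu i hi, zero_mul]
  refine ⟨⟨fun k => Submodule.span ℂ (eich e m x '' (Wf w k : Set (Fin (2 * ℓ)))), ?_, ?_, hsp⟩,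
    eich e m x, hf, fun k => rfl, ?_⟩
  · intro i j hij
    refine Submodule.span_mono (Set.image_mono ?_)
    intro a ha
    simp only [Finset.mem_coe, mem_Wf] at ha ⊢
    obtain ⟨b, hb, hb'⟩ := ha
    exact ⟨b, le_trans hb hij, hb'⟩
  · intro i
    rw [hf.finrank, card_Wf w i (by omega) (fun a b _ _ h => hT.inj a b h)]
  · intro l
    rw [bl_vD]
    unfold eich
    by_cases h1 : l.rev = m
    · have hl2 : l = m.rev := by rw [← h1, Fin.rev_rev]
      have hlS : l ∉ S := fun h => by
        have := hT.Slt l h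
        rw [hl2, hmr] at this; simp at this
      have hlv : l.val = ℓ := by rw [hl2, hmr]
      rw [if_pos h1, if_neg (by rintro (h | h); exact hlS h; omega), if_pos hlv]
      rw [hxz]
      · simp [x, m]
      · rw [Fin.lt_def]; simp [m]; omega
    · have hlm : l ≠ m.rev := fun h => h1 (by rw [h, Fin.rev_rev])
      have hlv : l.val ≠ ℓ := fun h => hlm (by rw [hmr]; exact Fin.ext h)
      by_cases h2 : l.rev = m.rev
      · have h3 : l = m := Fin.rev_injective h2
        rw [if_neg h1, if_pos h2, if_pos (Or.inr (by rw [h3]))]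
        rw [hmr]
        simp only [e, Pi.single_apply]
        rw [if_pos trivial, if_neg, sub_zero]
        intro h; have := congrArg Fin.val h; simp at this; omega
      · have h3 : l ≠ m := fun h => h2 (by rw [h])
        have h3v : l.val ≠ ℓ - 1 := fun h => h3 (Fin.ext h)
        rw [if_neg h1, if_neg h2]
        rw [bl_symm, hble, hmr, Fin.rev_rev]
        have a1 : (⟨ℓ, by omega⟩ : Fin (2 * ℓ)) ≠ l.rev := by rw [← hmr]; exact fun h => h2 h.symm
        have a2 : (⟨ℓ - 1, by omega⟩ : Fin (2 * ℓ)) ≠ l.rev := fun h => h1 h.symm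
        have a3 : (⟨ℓ - 1, by omega⟩ : Fin (2 * ℓ)) ≠ ⟨ℓ, by omega⟩ := by
          intro h; have := congrArg Fin.val h; simp at this; omega
        simp only [e, Pi.sub_apply, Pi.smul_apply, Pi.single_apply, if_neg a1, if_neg a2, if_neg a3,
          if_true, x, if_neg h3, h3v, hlv]
        by_cases hS : l ∈ S <;> simp [hS]

lemma w_surj {ℓ : ℕ} (w : Fin ℓ → Fin (2 * ℓ)) (hi : ∀ a b, w a = w b → a = b)
    (hr : ∀ a b, w a ≠ (w b).rev) (i : Fin (2 * ℓ)) : ∃ a, i = w a ∨ i = (w a).rev := by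
  let φ : Fin ℓ ⊕ Fin ℓ → Fin (2 * ℓ) := Sum.elim w (fun a => (w a).rev)
  have hφ : Function.Injective φ := by
    rintro (a | a) (b | b) h
    · exact congrArg _ (hi a b h)
    · exact absurd h (hr a b)
    · exact absurd h.symm (hr b a)
    · exact congrArg _ (hi a b (Fin.rev_injective h))
  have hb : Function.Bijective φ := by
    rw [Fintype.bijective_iff_injective_and_card]
    exact ⟨hφ, by simp [two_mul]⟩
  obtain ⟨a | a, h⟩ := hb.2 i
  · exact ⟨a, Or.inl h.symm⟩
  · exact ⟨a, Or.inr h.symm⟩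

lemma unique_w {ℓ : ℕ} {hl : 1 ≤ ℓ} {F : FlagD ℓ} {w w' : Fin ℓ → Fin (2 * ℓ)}
    {S S' : Finset (Fin (2 * ℓ))} (hT : IsT2 ℓ w S) (hT' : IsT2 ℓ w' S')
    (h : HasType ℓ hl F w S) (h' : HasType ℓ hl F w' S') : w = w' := by
  obtain ⟨f, hf, hV, hc⟩ := h
  obtain ⟨f', hf', hV', hc'⟩ := h'
  have s1 : ∀ k : Fin ℓ, k.val < ℓ - 1 → w k ∈ Wf w' k := by
    intro k hk
    by_contra hn
    have hmem : f (w k) ∈ F.V ⟨k, hk⟩ := by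
      rw [hV]
      exact Submodule.subset_span ⟨w k, by
        rw [Finset.mem_coe, mem_Wf]; exact ⟨k, le_rfl, rfl⟩, rfl⟩
    rw [hV'] at hmem
    have := hf'.span_coef _ _ hmem (w k) hn
    rw [bl_tri _ _ (w k) (hf.upper _) (hf'.upper _)] at this
    exact mul_ne_zero (hf.diag_ne _) (hf'.diag_ne _) this
  have s2 : ∀ m : ℕ, ∀ k : Fin ℓ, k.val = m → k.val < ℓ - 1 → w k = w' k := by
    intro m
    induction m using Nat.strong_induction_on with
    | _ m ih =>
      intro k hkm hk
      have := s1 k hk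
      rw [mem_Wf] at this
      obtain ⟨j, hj, hjk⟩ := this
      rcases lt_or_eq_of_le hj with hlt | heq
      · have := ih j.val (by omega) j rfl (by omega)
        have := hT.inj j k (by rw [this, hjk])
        omega
      · rw [← hjk, Fin.ext heq]
  funext k
  by_cases hk : k.val < ℓ - 1
  · exact s2 _ k rfl hk
  · have hk' : k.val = ℓ - 1 := by omega
    obtain ⟨j, hj⟩ := w_surj w hT.inj hT.rv (w' k)
    have hjk : j = k := by
      by_contra hne
      have hj2 : j.val < ℓ - 1 := by
        have : j.val ≠ k.val := fun h => hne (Fin.ext h)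
        omega
      have e := s2 _ j rfl hj2
      rw [e] at hj
      rcases hj with hj | hj
      · exact hne (hT'.inj _ _ hj).symm
      · exact hT'.rv _ _ hj
    subst hjk
    rcases hj with hj | hj
    · exact hj.symm
    · have a1 := hT.last j hk'
      have a2 := hT'.last j hk'
      rw [hj, Fin.val_rev] at a2
      omega

lemma unique_S_aux {ℓ : ℕ} {hl : 1 ≤ ℓ} {F : FlagD ℓ} {w : Fin ℓ → Fin (2 * ℓ)}
    {S S' : Finset (Fin (2 * ℓ))} (hT : IsT2 ℓ w S)
    (h : HasType ℓ hl F w S) (h' : HasType ℓ hl F w S') (i : Fin (2 * ℓ)) (hi : i ∈ S)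
    (a : Fin ℓ) (ha : w a = i.rev) :
    ∃ i' ∈ S', i ≤ i' ∧ ∃ a', w a' = i'.rev ∧ a' ≤ a := by
  obtain ⟨f, hf, hV, hc⟩ := h
  obtain ⟨f', hf', hV', hc'⟩ := h'
  have hilt := hT.Slt i hi
  have hal : a.val < ℓ - 1 := by
    by_contra hn
    have := hT.last a (by omega)
    rw [ha, Fin.val_rev] at this
    omega
  have h1 : bl (2 * ℓ) (vD ℓ hl) (f i.rev) ≠ 0 := by
    rw [hc, if_pos (Or.inl hi)]; exact one_ne_zero
  have hmem : f i.rev ∈ F.V ⟨a, hal⟩ := by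
    rw [hV]
    exact Submodule.subset_span ⟨i.rev, by
      rw [Finset.mem_coe, mem_Wf]; exact ⟨a, le_rfl, ha⟩, rfl⟩
  rw [hV'] at hmem
  rw [hf'.parseval] at h1
  obtain ⟨j, _, hj⟩ := Finset.exists_ne_zero_of_sum_ne_zero h1
  have hj1 := left_ne_zero_of_mul hj
  have hj2 := right_ne_zero_of_mul hj
  have hjW : j.rev ∈ Wf w a := by
    by_contra hn
    have := hf'.span_coef _ _ hmem j.rev hn
    rw [Fin.rev_rev] at this
    exact hj2 this
  have hij : i ≤ j := by
    by_contra hn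
    have := hf'.coef_zero (f i.rev) i.rev (hf.upper _) j.rev
      (Fin.rev_lt_rev.mpr (not_le.mp hn))
    rw [Fin.rev_rev] at this
    exact hj2 this
  rw [mem_Wf] at hjW
  obtain ⟨b, hb, hbj⟩ := hjW
  rw [hc'] at hj1
  by_cases hjS : j ∈ S'
  · exact ⟨j, hjS, hij, b, hbj, hb⟩
  · exfalso
    have hjl : j.val = ℓ - 1 ∨ j.val = ℓ := by
      by_contra hn
      push Not at hn
      apply hj1
      simp [hjS, hn.1, hn.2]
    have hba : b < a := by
      refine lt_of_le_of_ne hb ?_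
      intro e
      have e' : b = a := e
      rw [e', ha] at hbj
      have := Fin.rev_injective hbj
      rw [← this] at hjl
      omega
    obtain ⟨c1, c2, _⟩ := hT.Sord b a i hba hi ha
    rw [hbj, Fin.val_rev] at c1 c2
    omega

lemma unique_S_sub {ℓ : ℕ} {hl : 1 ≤ ℓ} {F : FlagD ℓ} {w : Fin ℓ → Fin (2 * ℓ)}
    {S S' : Finset (Fin (2 * ℓ))} (hT : IsT2 ℓ w S) (hT' : IsT2 ℓ w S')
    (h : HasType ℓ hl F w S) (h' : HasType ℓ hl F w S') : S ⊆ S' := by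
  intro i hi
  obtain ⟨a, ha⟩ := hT.Sex i hi
  obtain ⟨i', hi', h1, a', ha', h2⟩ := unique_S_aux hT h h' i hi a ha
  obtain ⟨i'', hi'', h3, a'', ha'', h4⟩ := unique_S_aux hT' h' h i' hi' a' ha'
  have : i = i'' := by
    by_contra hne
    have hlt : a'' < a := by
      refine lt_of_le_of_ne (h4.trans h2) ?_
      intro e
      rw [e, ha] at ha''
      exact hne (Fin.rev_injective ha'')
    have := (hT.Sord a'' a i hlt hi ha).2.2 i'' hi'' ha''
    exact absurd this (not_lt.mpr (h1.trans h3))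
  have : i = i' := le_antisymm h1 (this ▸ h3)
  exact this ▸ hi'

lemma HasType.unique {ℓ : ℕ} {hl : 1 ≤ ℓ} {F : FlagD ℓ} {w w' : Fin ℓ → Fin (2 * ℓ)}
    {S S' : Finset (Fin (2 * ℓ))} (hT : IsT2 ℓ w S) (hT' : IsT2 ℓ w' S')
    (h : HasType ℓ hl F w S) (h' : HasType ℓ hl F w' S') : w = w' ∧ S = S' := by
  have e := unique_w hT hT' h h'
  subst e
  exact ⟨rfl, (unique_S_sub hT hT' h h').antisymm (unique_S_sub hT' hT h' h)⟩

lemma stepA (ℓ : ℕ) (F : FlagD ℓ) (k : ℕ) (hk : k ≤ ℓ - 1) :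
    ∃ (f : Fin (2 * ℓ) → Fin (2 * ℓ) → ℂ) (w : Fin ℓ → Fin (2 * ℓ)), Fr (2 * ℓ) f ∧
      (∀ a b : Fin ℓ, a.val < k → b.val < k → w a = w b → a = b) ∧
      (∀ a b : Fin ℓ, a.val < k → b.val < k → w a ≠ (w b).rev) ∧
      ∀ a : Fin ℓ, a.val < k → ∀ h : a.val < ℓ - 1, f (w a) ∈ F.V ⟨a, h⟩ := by
  classical
  induction k with
  | zero =>
    exact ⟨fun i => Pi.single i 1, fun a => ⟨a.val, by omega⟩, std_Fr _, by simp, by simp, by simp⟩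
  | succ k ih =>
    obtain ⟨f, w, hf, hinj, hrv, hmem⟩ := ih (by omega)
    let kk : Fin (ℓ - 1) := ⟨k, by omega⟩
    let I : Finset (Fin (2 * ℓ)) := (Finset.univ.filter (fun j : Fin ℓ => j.val < k)).image w
    have hI : ∀ i, i ∈ I ↔ ∃ j : Fin ℓ, j.val < k ∧ w j = i := by
      intro i; simp [I]
    have hIc : I.card ≤ k := by
      refine Finset.card_image_le.trans ?_
      have : (Finset.univ.filter (fun j : Fin ℓ => j.val < k)) = Finset.Iio (⟨k, by omega⟩ : Fin ℓ) := by
        ext j; simp [Fin.lt_def]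
      rw [this, Fin.card_Iio]
    have hIV : ∀ i ∈ I, f i ∈ F.V kk := by
      intro i hi
      obtain ⟨j, hj, rfl⟩ := (hI i).1 hi
      exact F.mono ⟨j, by omega⟩ kk (le_of_lt hj) (hmem j hj (by omega))
    obtain ⟨x, hxV, hxU⟩ : ∃ x ∈ F.V kk, x ∉ Submodule.span ℂ (f '' (I : Set (Fin (2 * ℓ)))) := by
      by_contra hn
      push Not at hn
      have h1 := Submodule.finrank_mono (show F.V kk ≤ _ from hn)
      rw [hf.finrank, F.dimV] at h1
      simp [kk] at h1
      omega
    have hiso : ∀ u ∈ F.V kk, ∀ u' ∈ F.V kk, bl (2 * ℓ) u u' = 0 := by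
      intro u hu u' hu'
      rw [← bform_bl]; exact F.isot kk u hu u' hu'
    let y := x - ∑ i ∈ I, bl (2 * ℓ) x (f i.rev) • f i
    have hyV : y ∈ F.V kk :=
      Submodule.sub_mem _ hxV (Submodule.sum_mem _ fun i hi => Submodule.smul_mem _ _ (hIV i hi))
    have hyU : y ∉ Submodule.span ℂ (f '' (I : Set (Fin (2 * ℓ)))) := by
      intro hy
      apply hxU
      have : x = y + ∑ i ∈ I, bl (2 * ℓ) x (f i.rev) • f i := by simp [y]
      rw [this]
      exact Submodule.add_mem _ hy (Submodule.sum_mem _ fun i hi =>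
        Submodule.smul_mem _ _ (Submodule.subset_span ⟨i, hi, rfl⟩))
    have hyI : ∀ l ∈ I, bl (2 * ℓ) y (f l.rev) = 0 := by
      intro l hlI
      simp only [y, map_sub, map_sum, map_smul, LinearMap.sub_apply, LinearMap.sum_apply,
        LinearMap.smul_apply, hf.orth, smul_eq_mul]
      rw [Finset.sum_eq_single l]
      · simp
      · intro j _ hj
        rw [if_neg (fun e => hj (Fin.rev_injective e).symm), mul_zero]
      · intro h; exact absurd hlI h
    have hyI' : ∀ l : Fin (2 * ℓ), l.rev ∈ I → bl (2 * ℓ) y (f l.rev) = 0 :=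
      fun l h => hiso _ hyV _ (hIV _ h)
    let supp : Finset (Fin (2 * ℓ)) := Finset.univ.filter (fun l => bl (2 * ℓ) y (f l.rev) ≠ 0)
    have hne : supp.Nonempty := by
      by_contra hn
      apply hyU
      refine hf.mem_span _ _ fun i _ => ?_
      by_contra h
      exact hn ⟨i, by simp [supp, h]⟩
    let m := supp.max' hne
    have hm : bl (2 * ℓ) y (f m.rev) ≠ 0 := by
      have := supp.max'_mem hne
      simpa [supp] using this
    have hmz : ∀ i, m < i → bl (2 * ℓ) y (f i.rev) = 0 := by
      intro i hi
      by_contra h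
      exact absurd (supp.le_max' i (by simp [supp, h])) (not_le.mpr hi)
    have hmI : m ∉ I := fun h => hm (hyI m h)
    have hmI' : m.rev ∉ I := fun h => hm (hyI' m h)
    let z := (bl (2 * ℓ) y (f m.rev))⁻¹ • y
    have hzV : z ∈ F.V kk := Submodule.smul_mem _ _ hyV
    have hf' := hf.eich m z (rev_ne ℓ m) (hiso _ hzV _ hzV) (by simp [z, hm])
      (fun i hi => by simp [z, hmz i hi])
    have hsame : ∀ i ∈ I, eich f m z i = f i := by
      intro i hi
      unfold eich
      have n1 : i ≠ m := fun h => hmI (h ▸ hi)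
      have n2 : i ≠ m.rev := fun h => hmI' (h ▸ hi)
      rw [if_neg n1, if_neg n2, hiso _ (hIV i hi) _ hzV]
      simp
    have hk0 : k < ℓ := by omega
    have hwI : ∀ a : Fin ℓ, a.val < k → w a ∈ I := fun a ha => (hI _).2 ⟨a, ha, rfl⟩
    refine ⟨eich f m z, Function.update w ⟨k, hk0⟩ m, hf', ?_, ?_, ?_⟩
    · intro a b ha hb hab
      by_cases h1 : a = ⟨k, hk0⟩
      · by_cases h2 : b = ⟨k, hk0⟩
        · rw [h1, h2]
        · have hb' : b.val < k := by
            have : b.val ≠ k := fun h => h2 (Fin.ext h)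
            omega
          rw [h1, Function.update_self, Function.update_of_ne h2] at hab
          exact absurd (hab ▸ hwI b hb') hmI
      · have ha' : a.val < k := by
          have : a.val ≠ k := fun h => h1 (Fin.ext h)
          omega
        by_cases h2 : b = ⟨k, hk0⟩
        · rw [h2, Function.update_self, Function.update_of_ne h1] at hab
          exact absurd (hab ▸ hwI a ha') hmI
        · have hb' : b.val < k := by
            have : b.val ≠ k := fun h => h2 (Fin.ext h)
            omega
          rw [Function.update_of_ne h1, Function.update_of_ne h2] at hab
          exact hinj a b ha' hb' hab
    · intro a b ha hb hab
      by_cases h1 : a = ⟨k, hk0⟩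
      · by_cases h2 : b = ⟨k, hk0⟩
        · rw [h1, h2] at hab
          exact rev_ne ℓ _ hab
        · have hb' : b.val < k := by
            have : b.val ≠ k := fun h => h2 (Fin.ext h)
            omega
          rw [h1, Function.update_self, Function.update_of_ne h2] at hab
          refine hmI' ?_
          rw [hab, Fin.rev_rev]; exact hwI b hb'
      · have ha' : a.val < k := by
          have : a.val ≠ k := fun h => h1 (Fin.ext h)
          omega
        by_cases h2 : b = ⟨k, hk0⟩
        · rw [h2, Function.update_self, Function.update_of_ne h1] at hab
          exact absurd (hab ▸ hwI a ha') hmI'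
        · have hb' : b.val < k := by
            have : b.val ≠ k := fun h => h2 (Fin.ext h)
            omega
          rw [Function.update_of_ne h1, Function.update_of_ne h2] at hab
          exact hrv a b ha' hb' hab
    · intro a ha h
      by_cases h1 : a = ⟨k, hk0⟩
      · subst h1
        rw [Function.update_self]
        unfold eich
        rw [if_pos rfl]
        exact hzV
      · have ha' : a.val < k := by
          have : a.val ≠ k := fun h => h1 (Fin.ext h)
          omega
        rw [Function.update_of_ne h1, hsame _ (hwI a ha')]
        exact hmem a ha' h

lemma stepA' (ℓ : ℕ) (hl : 1 ≤ ℓ) (F : FlagD ℓ) :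
    ∃ (f : Fin (2 * ℓ) → Fin (2 * ℓ) → ℂ) (w : Fin ℓ → Fin (2 * ℓ)), Fr (2 * ℓ) f ∧
      (∀ a b : Fin ℓ, w a = w b → a = b) ∧
      (∀ a b : Fin ℓ, w a ≠ (w b).rev) ∧
      (∀ a : Fin ℓ, a.val = ℓ - 1 → (w a).val < ℓ) ∧
      ∀ a : Fin ℓ, ∀ h : a.val < ℓ - 1, f (w a) ∈ F.V ⟨a, h⟩ := by
  classical
  obtain ⟨f, w, hf, hinj, hrv, hmem⟩ := stepA ℓ F (ℓ - 1) le_rfl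
  let I : Finset (Fin (2 * ℓ)) := (Finset.univ.filter (fun j : Fin ℓ => j.val < ℓ - 1)).image w
  have hI : ∀ i, i ∈ I ↔ ∃ j : Fin ℓ, j.val < ℓ - 1 ∧ w j = i := by
    intro i; simp [I]
  have hIc : I.card ≤ ℓ - 1 := by
    refine Finset.card_image_le.trans ?_
    have : (Finset.univ.filter (fun j : Fin ℓ => j.val < ℓ - 1)) =
        Finset.Iio (⟨ℓ - 1, by omega⟩ : Fin ℓ) := by
      ext j; simp [Fin.lt_def]
    rw [this, Fin.card_Iio]
  have hex : ∃ i, i ∉ I ∪ I.image Fin.rev := by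
    by_contra hn
    push Not at hn
    have h1 : (Finset.univ : Finset (Fin (2 * ℓ))).card ≤ (I ∪ I.image Fin.rev).card :=
      Finset.card_le_card fun i _ => hn i
    have h2 := Finset.card_union_le I (I.image Fin.rev)
    have h3 : (I.image Fin.rev).card ≤ I.card := Finset.card_image_le
    rw [Finset.card_univ, Fintype.card_fin] at h1
    omega
  have hex' : ∃ i : Fin (2 * ℓ), i.val < ℓ ∧ i ∉ I ∧ i.rev ∉ I := by
    obtain ⟨i, hi⟩ := hex
    rw [Finset.mem_union, not_or] at hi
    have h2 : i.rev ∉ I := fun h => hi.2 (Finset.mem_image.2 ⟨i.rev, h, Fin.rev_rev i⟩)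
    by_cases h : i.val < ℓ
    · exact ⟨i, h, hi.1, h2⟩
    · refine ⟨i.rev, ?_, h2, ?_⟩
      · rw [Fin.val_rev]; omega
      · rw [Fin.rev_rev]; exact hi.1
  obtain ⟨m, hml, hmI, hmI'⟩ := hex'
  have hk0 : ℓ - 1 < ℓ := by omega
  have hwI : ∀ a : Fin ℓ, a.val < ℓ - 1 → w a ∈ I := fun a ha => (hI _).2 ⟨a, ha, rfl⟩
  have hlt : ∀ a : Fin ℓ, a ≠ ⟨ℓ - 1, hk0⟩ → a.val < ℓ - 1 := by
    intro a ha
    have : a.val ≠ ℓ - 1 := fun h => ha (Fin.ext h)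
    omega
  refine ⟨f, Function.update w ⟨ℓ - 1, hk0⟩ m, hf, ?_, ?_, ?_, ?_⟩
  · intro a b hab
    by_cases h1 : a = ⟨ℓ - 1, hk0⟩
    · by_cases h2 : b = ⟨ℓ - 1, hk0⟩
      · rw [h1, h2]
      · rw [h1, Function.update_self, Function.update_of_ne h2] at hab
        exact absurd (hab ▸ hwI b (hlt b h2)) hmI
    · by_cases h2 : b = ⟨ℓ - 1, hk0⟩
      · rw [h2, Function.update_self, Function.update_of_ne h1] at hab
        exact absurd (hab ▸ hwI a (hlt a h1)) hmI
      · rw [Function.update_of_ne h1, Function.update_of_ne h2] at hab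
        exact hinj a b (hlt a h1) (hlt b h2) hab
  · intro a b hab
    by_cases h1 : a = ⟨ℓ - 1, hk0⟩
    · by_cases h2 : b = ⟨ℓ - 1, hk0⟩
      · rw [h1, h2] at hab
        exact rev_ne ℓ _ hab
      · rw [h1, Function.update_self, Function.update_of_ne h2] at hab
        refine hmI' ?_
        rw [hab, Fin.rev_rev]; exact hwI b (hlt b h2)
    · by_cases h2 : b = ⟨ℓ - 1, hk0⟩
      · rw [h2, Function.update_self, Function.update_of_ne h1] at hab
        exact absurd (hab ▸ hwI a (hlt a h1)) hmI'
      · rw [Function.update_of_ne h1, Function.update_of_ne h2] at hab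
        exact hrv a b (hlt a h1) (hlt b h2) hab
  · intro a ha
    have : a = ⟨ℓ - 1, hk0⟩ := Fin.ext ha
    rw [this, Function.update_self]; exact hml
  · intro a h
    have h1 : a ≠ ⟨ℓ - 1, hk0⟩ := fun e => by rw [e] at h; simp at h
    rw [Function.update_of_ne h1]
    exact hmem a h h

lemma exists_rank {ℓ : ℕ} (w : Fin ℓ → Fin (2 * ℓ)) (hi : ∀ a b, w a = w b → a = b)
    (hr : ∀ a b, w a ≠ (w b).rev) : ∃ r : Fin (2 * ℓ) → ℕ, (∀ a, r (w a) = a.val) ∧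
      (∀ i, r i + r i.rev = 2 * ℓ - 1) ∧ Function.Injective r ∧
      ∀ i, r i < ℓ → ∃ a, w a = i := by
  classical
  choose p hp using w_surj w hi hr
  have hp1 : ∀ a, p (w a) = a := by
    intro a
    rcases hp (w a) with h | h
    · exact (hi _ _ h).symm
    · exact absurd h (hr _ _)
  have hp2 : ∀ a, p (w a).rev = a := by
    intro a
    rcases hp (w a).rev with h | h
    · exact absurd h.symm (hr _ _)
    · exact (hi _ _ (Fin.rev_injective h)).symm
  let r : Fin (2 * ℓ) → ℕ := fun i => if i = w (p i) then (p i).val else 2 * ℓ - 1 - (p i).val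
  have r1 : ∀ a, r (w a) = a.val := by intro a; simp [r, hp1]
  have r2 : ∀ a, r (w a).rev = 2 * ℓ - 1 - a.val := by
    intro a
    simp only [r, hp2]
    rw [if_neg (fun h => hr a a h.symm)]
  refine ⟨r, r1, ?_, ?_, ?_⟩
  · intro i
    obtain ⟨a, rfl | rfl⟩ := w_surj w hi hr i
    · rw [r1, r2]; omega
    · rw [Fin.rev_rev, r1, r2]; omega
  · intro i j hij
    obtain ⟨a, rfl | rfl⟩ := w_surj w hi hr i
    · obtain ⟨b, rfl | rfl⟩ := w_surj w hi hr j
      · rw [r1, r1] at hij; rw [Fin.ext hij]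
      · rw [r1, r2] at hij; omega
    · obtain ⟨b, rfl | rfl⟩ := w_surj w hi hr j
      · rw [r1, r2] at hij; omega
      · rw [r2, r2] at hij
        have : a = b := by ext; omega
        rw [this]
  · intro i h
    obtain ⟨a, rfl | rfl⟩ := w_surj w hi hr i
    · exact ⟨a, rfl⟩
    · rw [r2] at h; omega

lemma vD_coef_zero {ℓ : ℕ} (hl : 1 ≤ ℓ) {f : Fin (2 * ℓ) → Fin (2 * ℓ) → ℂ} (hf : Fr (2 * ℓ) f)
    (l : Fin (2 * ℓ)) (h : ℓ < l.val) : bl (2 * ℓ) (vD ℓ hl) (f l.rev) = 0 := by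
  rw [bl_vD, hf.upper, hf.upper, sub_zero]
  · rw [Fin.lt_def, Fin.val_rev]; simp; omega
  · rw [Fin.lt_def, Fin.val_rev]; simp; omega

lemma vD_coef_mul {ℓ : ℕ} (hl : 1 ≤ ℓ) {f : Fin (2 * ℓ) → Fin (2 * ℓ) → ℂ} (hf : Fr (2 * ℓ) f)
    (p q : Fin (2 * ℓ)) (hp : p.val = ℓ - 1) (hq : q.val = ℓ) :
    bl (2 * ℓ) (vD ℓ hl) (f p.rev) * bl (2 * ℓ) (vD ℓ hl) (f q.rev) = -1 := by
  have e1 : p.rev = q := by ext; rw [Fin.val_rev]; omega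
  have e2 : q.rev = p := by ext; rw [Fin.val_rev]; omega
  have e3 : (⟨ℓ, by omega⟩ : Fin (2 * ℓ)) = q := Fin.ext hq.symm
  have e4 : (⟨ℓ - 1, by omega⟩ : Fin (2 * ℓ)) = p := Fin.ext hp.symm
  have hpq : p < q := by rw [Fin.lt_def]; omega
  rw [bl_vD, bl_vD, e1, e2, e3, e4, hf.upper p q hpq]
  have h1 := hf.orth q q
  rw [if_neg (rev_ne ℓ q), bl_apply] at h1
  have h2 : ∑ i : Fin (2 * ℓ), f q i * f q i.rev = f q p * f q q + f q q * f q p := by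
    have hsub : ∑ i ∈ ({p, q} : Finset (Fin (2 * ℓ))), f q i * f q i.rev =
        ∑ i : Fin (2 * ℓ), f q i * f q i.rev := by
      refine Finset.sum_subset (Finset.subset_univ _) ?_
      intro i _ hi
      simp only [Finset.mem_insert, Finset.mem_singleton, not_or] at hi
      rcases lt_or_ge q i with h | h
      · rw [hf.upper q i h, zero_mul]
      · rw [hf.upper q i.rev, mul_zero]
        have a1 : i.val ≠ p.val := fun h => hi.1 (Fin.ext h)
        have a2 : i.val ≠ q.val := fun h => hi.2 (Fin.ext h)
        have a3 : i.val ≤ q.val := h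
        rw [Fin.lt_def, Fin.val_rev]; omega
    rw [← hsub, Finset.sum_pair (ne_of_lt hpq), e1, e2]
  rw [h2] at h1
  have h3 : f q p = 0 := by
    have : f q q * f q p = 0 := by linear_combination h1 / 2
    exact (mul_eq_zero.1 this).resolve_left (hf.diag_ne q)
  have h4 := hf.diag p
  rw [e1] at h4
  rw [h3]
  linear_combination -h4

lemma kill {ℓ : ℕ} (hl : 1 ≤ ℓ) (F : FlagD ℓ) (w : Fin ℓ → Fin (2 * ℓ))
    (r : Fin (2 * ℓ) → ℕ) (r1 : ∀ a, r (w a) = a.val)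
    (r2 : ∀ i : Fin (2 * ℓ), r i + r i.rev = 2 * ℓ - 1)
    (r3 : ∀ i, r i < ℓ → ∃ a, w a = i) (N : ℕ) :
    ∀ f, Fr (2 * ℓ) f → (∀ a : Fin ℓ, ∀ h : a.val < ℓ - 1, f (w a) ∈ F.V ⟨a, h⟩) →
    (Finset.univ.filter (fun l : Fin (2 * ℓ) => bl (2 * ℓ) (vD ℓ hl) (f l.rev) ≠ 0)).card = N →
    ∃ f', Fr (2 * ℓ) f' ∧ (∀ a : Fin ℓ, ∀ h : a.val < ℓ - 1, f' (w a) ∈ F.V ⟨a, h⟩) ∧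
      ∀ i j : Fin (2 * ℓ), bl (2 * ℓ) (vD ℓ hl) (f' i.rev) ≠ 0 →
        bl (2 * ℓ) (vD ℓ hl) (f' j.rev) ≠ 0 → i ≠ j.rev → i < j → ¬ r i < r j := by
  classical
  induction N using Nat.strong_induction_on with
  | _ N ih =>
  intro f hf hV hN
  by_cases hdone : ∀ i j : Fin (2 * ℓ), bl (2 * ℓ) (vD ℓ hl) (f i.rev) ≠ 0 →
        bl (2 * ℓ) (vD ℓ hl) (f j.rev) ≠ 0 → i ≠ j.rev → i < j → ¬ r i < r j
  · exact ⟨f, hf, hV, hdone⟩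
  push Not at hdone
  obtain ⟨i, j, hi, hj, hij, hlt, hr⟩ := hdone
  have hil : i.val + 1 < ℓ := by
    have a1 : i.val < j.val := hlt
    have a2 : j.val ≤ ℓ := by
      by_contra h; exact hj (vD_coef_zero hl hf j (by omega))
    have a3 : i.val ≠ j.rev.val := fun h => hij (Fin.ext h)
    rw [Fin.val_rev] at a3
    omega
  have hir0 : bl (2 * ℓ) (vD ℓ hl) (f i) = 0 := by
    have := vD_coef_zero hl hf i.rev (by rw [Fin.val_rev]; omega)
    rwa [Fin.rev_rev] at this
  set c := bl (2 * ℓ) (vD ℓ hl) (f i.rev) / bl (2 * ℓ) (vD ℓ hl) (f j.rev) with hcdef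
  let x := f j + c • f i
  have hne : i ≠ j := ne_of_lt hlt
  have hjr := rev_ne ℓ j
  have hirr := rev_ne ℓ i
  have hji : j ≠ i.rev := fun h => hij (by rw [h, Fin.rev_rev])
  have hbx : ∀ l : Fin (2 * ℓ), bl (2 * ℓ) (f l) x = (if j = l.rev then 1 else 0) +
      c * (if i = l.rev then 1 else 0) := by
    intro l; simp [x, hf.orth]
  have hf' : Fr (2 * ℓ) (eich f j x) := by
    refine hf.eich j x hjr ?_ ?_ ?_
    · simp [x, hf.orth, hjr, hirr, hij, hji]
    · rw [bl_symm, hbx]; simp [hne]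
    · intro l hlj
      rw [bl_symm, hbx, Fin.rev_rev, if_neg (ne_of_lt hlj), if_neg (ne_of_lt (hlt.trans hlj))]
      simp
  -- values of the new frame
  have e1 : eich f j x j = x := by simp [eich]
  have e2 : eich f j x i.rev = f i.rev - c • f j.rev := by
    unfold eich
    rw [if_neg hji.symm, if_neg (fun h => hne (Fin.rev_injective h)), hbx, Fin.rev_rev,
      if_neg hne.symm, if_pos rfl]
    simp
  have e3 : ∀ l, l ≠ j → l ≠ i.rev → eich f j x l = f l := by
    intro l h1 h2
    unfold eich
    rw [if_neg h1]
    by_cases h3 : l = j.rev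
    · rw [if_pos h3, h3]
    · rw [if_neg h3, hbx, if_neg (fun h => h3 (by rw [h, Fin.rev_rev])),
        if_neg (fun h => h2 (by rw [h, Fin.rev_rev]))]
      simp
  have hrr : r j.rev < r i.rev := by
    have := r2 i; have := r2 j; omega
  have hlow : ∀ (a : Fin ℓ) (h : a.val < ℓ - 1) (l : Fin (2 * ℓ)), r l < a.val →
      f l ∈ F.V ⟨a, h⟩ := by
    intro a h l hla
    obtain ⟨b, rfl⟩ := r3 l (by omega)
    rw [r1] at hla
    exact F.mono ⟨b, by omega⟩ ⟨a, h⟩ (le_of_lt hla) (hV b (by omega))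
  have hV' : ∀ a : Fin ℓ, ∀ h : a.val < ℓ - 1, eich f j x (w a) ∈ F.V ⟨a, h⟩ := by
    intro a h
    have hVa := hV a h
    have hra := r1 a
    by_cases h1 : w a = j
    · rw [h1] at hVa hra ⊢
      rw [e1]
      exact Submodule.add_mem _ hVa (Submodule.smul_mem _ _ (hlow a h i (by omega)))
    · by_cases h2 : w a = i.rev
      · rw [h2] at hVa hra ⊢
        rw [e2]
        exact Submodule.sub_mem _ hVa (Submodule.smul_mem _ _ (hlow a h j.rev (by omega)))
      · rw [e3 _ h1 h2]; exact hVa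
  refine ih _ ?_ (eich f j x) hf' hV' rfl
  rw [← hN]
  have hzero : bl (2 * ℓ) (vD ℓ hl) (eich f j x i.rev) = 0 := by
    rw [e2]
    simp only [map_sub, map_smul, smul_eq_mul, hcdef]
    rw [div_mul_cancel₀ _ hj, sub_self]
  refine Finset.card_lt_card ⟨?_, ?_⟩
  · intro l hlm
    simp only [Finset.mem_filter, Finset.mem_univ, true_and] at hlm ⊢
    by_cases h1 : l.rev = j
    · rw [h1, e1] at hlm
      simp only [x, map_add, map_smul, hir0, smul_zero, add_zero] at hlm
      rwa [h1]
    · by_cases h2 : l.rev = i.rev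
      · rw [h2] at hlm; exact absurd hzero hlm
      · rwa [e3 _ h1 h2] at hlm
  · intro hsub
    have : i ∈ Finset.univ.filter (fun l : Fin (2 * ℓ) =>
        bl (2 * ℓ) (vD ℓ hl) (eich f j x l.rev) ≠ 0) := hsub (by simp [hi])
    simp only [Finset.mem_filter, Finset.mem_univ, true_and] at this
    exact this hzero

lemma exists_type (ℓ : ℕ) (hl : 1 ≤ ℓ) (F : FlagD ℓ) :
    ∃ w S, IsT2 ℓ w S ∧ HasType ℓ hl F w S := by
  classical
  obtain ⟨f0, w, hf0, hinj, hrv, hlast, hV0⟩ := stepA' ℓ hl F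
  obtain ⟨r, r1, r2, rinj, r3⟩ := exists_rank w hinj hrv
  obtain ⟨f, hf, hV, hkill⟩ := kill hl F w r r1 r2 r3 _ f0 hf0 hV0 rfl
  let a : Fin (2 * ℓ) → ℂ := fun l => bl (2 * ℓ) (vD ℓ hl) (f l.rev)
  let S : Finset (Fin (2 * ℓ)) := Finset.univ.filter (fun l => l.val + 1 < ℓ ∧ a l ≠ 0)
  have hS : ∀ l, l ∈ S ↔ l.val + 1 < ℓ ∧ a l ≠ 0 := by intro l; simp [S]
  let p : Fin (2 * ℓ) := ⟨ℓ - 1, by omega⟩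
  let q : Fin (2 * ℓ) := ⟨ℓ, by omega⟩
  have hpq : a p * a q = -1 := vD_coef_mul hl hf p q rfl rfl
  have hap : a p ≠ 0 := by intro h; rw [h] at hpq; simp at hpq
  have haq : a q ≠ 0 := by intro h; rw [h] at hpq; simp at hpq
  have hrevp : p.rev = q := by ext; rw [Fin.val_rev]; simp [p, q]; omega
  have hrevq : q.rev = p := by rw [← hrevp, Fin.rev_rev]
  -- order facts
  have ordp : ∀ i ∈ S, r p < r i := by
    intro i hi
    obtain ⟨h1, h2⟩ := (hS i).1 hi
    have hlt : i < p := by rw [Fin.lt_def]; simp [p]; omega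
    have := hkill i p h2 hap (by rw [hrevp]; intro h; rw [h] at h1; simp [q] at h1; try omega) hlt
    refine lt_of_le_of_ne (not_lt.mp this) fun h => ne_of_gt hlt (rinj h)
  have ordq : ∀ i ∈ S, r q < r i := by
    intro i hi
    obtain ⟨h1, h2⟩ := (hS i).1 hi
    have hlt : i < q := by rw [Fin.lt_def]; simp [q]; omega
    have := hkill i q h2 haq (by rw [hrevq]; intro h; rw [h] at h1; simp [p] at h1; omega) hlt
    refine lt_of_le_of_ne (not_lt.mp this) fun h => ne_of_gt hlt (rinj h)
  have ordS : ∀ i ∈ S, ∀ j ∈ S, i < j → r j < r i := by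
    intro i hi j hj hlt
    obtain ⟨h1, h2⟩ := (hS i).1 hi
    obtain ⟨h3, h4⟩ := (hS j).1 hj
    have := hkill i j h2 h4 (by
      intro h; have := congrArg Fin.val h; rw [Fin.val_rev] at this; omega) hlt
    refine lt_of_le_of_ne (not_lt.mp this) fun h => ne_of_gt hlt (rinj h)
  have hrpq : r p + r q = 2 * ℓ - 1 := by rw [← hrevp]; exact r2 p
  have hT : IsT2 ℓ w S := by
    refine ⟨hinj, hrv, hlast, fun i hi => ((hS i).1 hi).1, ?_, ?_⟩
    · intro i hi
      refine r3 i.rev ?_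
      have := r2 i; have := ordp i hi; have := ordq i hi
      omega
    · intro b c j hbc hj hc
      have hbc' : b.val < c.val := hbc
      have hc' := r1 c
      rw [hc] at hc'
      have hb' := r1 b
      have hrj := r2 j
      refine ⟨?_, ?_, ?_⟩
      · intro h
        have : w b = p := Fin.ext h
        rw [this] at hb'
        have := ordq j hj
        omega
      · intro h
        have : w b = q := Fin.ext h
        rw [this] at hb'
        have := ordp j hj
        omega
      · intro i hi hbi
        rw [hbi] at hb'
        have hri := r2 i
        by_contra hn
        rcases lt_or_eq_of_le (not_lt.mp hn) with h | h
        · have := ordS j hj i hi h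
          omega
        · rw [h] at hc'
          omega
  refine ⟨w, S, hT, ?_⟩
  -- scaling
  let t : Fin (2 * ℓ) → ℂ := fun i =>
    if i.val < ℓ then (if a i = 0 then 1 else a i) else (if a i.rev = 0 then 1 else (a i.rev)⁻¹)
  have ht : ∀ i : Fin (2 * ℓ), t i * t i.rev = 1 := by
    intro i
    by_cases h : i.val < ℓ
    · have h' : ¬ i.rev.val < ℓ := by rw [Fin.val_rev]; omega
      simp only [t, if_pos h, if_neg h', Fin.rev_rev]
      by_cases h0 : a i = 0
      · simp [h0]
      · simp [h0]
    · have h' : i.rev.val < ℓ := by rw [Fin.val_rev]; omega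
      simp only [t, if_pos h', if_neg h]
      by_cases h0 : a i.rev = 0
      · simp [h0]
      · simp [h0]
  have hf' : Fr (2 * ℓ) (fun i => t i • f i) := by
    constructor
    · intro i j
      simp only [map_smul, LinearMap.smul_apply, smul_eq_mul, hf.orth]
      by_cases h : j = i.rev
      · rw [if_pos h, h, mul_one, mul_comm, ht]
      · rw [if_neg h]; simp
    · intro i k h
      simp [hf.upper i k h]
  refine ⟨fun i => t i • f i, hf', ?_, ?_⟩
  · intro k
    symm
    refine Submodule.eq_of_le_of_finrank_eq ?_ ?_
    · rw [Submodule.span_le]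
      rintro _ ⟨i, hi, rfl⟩
      rw [Finset.mem_coe, mem_Wf] at hi
      obtain ⟨b, hb, rfl⟩ := hi
      have hbl : b.val < ℓ - 1 := by omega
      exact Submodule.smul_mem _ _ (F.mono ⟨b, hbl⟩ k hb (hV b hbl))
    · rw [hf'.finrank, F.dimV, card_Wf w k (by omega) (fun a b _ _ h => hinj a b h)]
  · intro l
    simp only [map_smul, smul_eq_mul]
    change t l.rev * a l = _
    by_cases h : l.val < ℓ
    · have h' : ¬ l.rev.val < ℓ := by rw [Fin.val_rev]; omega
      simp only [t, if_neg h', Fin.rev_rev]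
      have hll : l.val ≠ ℓ := by omega
      by_cases h0 : a l = 0
      · have h1 : l ∉ S := fun h => ((hS l).1 h).2 h0
        have h2 : l.val ≠ ℓ - 1 := fun h => hap (by
          have : l = p := Fin.ext h
          rw [← this]; exact h0)
        simp [h0, h1, h2, hll]
      · have h1 : l ∈ S ∨ l.val = ℓ - 1 := by
          by_cases h3 : l.val = ℓ - 1
          · exact Or.inr h3
          · exact Or.inl ((hS l).2 ⟨by omega, h0⟩)
        rw [if_pos h1, if_neg h0, inv_mul_cancel₀ h0]
    · have h1 : l ∉ S := fun h => by have := ((hS l).1 h).1; omega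
      have h2 : l.val ≠ ℓ - 1 := by omega
      by_cases h3 : l.val = ℓ
      · have hlq : l = q := Fin.ext h3
        rw [if_neg (by rintro (h | h); exact h1 h; exact h2 h), if_pos h3]
        rw [hlq, hrevq]
        have : p.val < ℓ := by simp [p]; omega
        simp only [t, if_pos this, if_neg hap]
        exact hpq
      · have : a l = 0 := vD_coef_zero hl hf l (by omega)
        simp [this, h1, h2, h3]


lemma card_quot (ℓ : ℕ) (hl : 1 ≤ ℓ) :
    Nat.card (Quot (flagDRel ℓ hl)) =
      Nat.card {ws : (Fin ℓ → Fin (2 * ℓ)) × Finset (Fin (2 * ℓ)) // IsT2 ℓ ws.1 ws.2} := by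
  choose w S hT hS using exists_type ℓ hl
  refine Nat.card_eq_of_bijective
    (Quot.lift (fun F => (⟨(w F, S F), hT F⟩ :
      {ws : (Fin ℓ → Fin (2 * ℓ)) × Finset (Fin (2 * ℓ)) // IsT2 ℓ ws.1 ws.2})) ?_) ⟨?_, ?_⟩
  · intro F F' h
    have := HasType.unique (hT F) (hT F') (hS F) (HasType.of_rel h (hS F'))
    simp [this.1, this.2]
  · rintro ⟨F⟩ ⟨F'⟩ h
    simp only [Subtype.mk.injEq, Prod.mk.injEq] at h
    refine Quot.sound (HasType.rel (hS F) ?_)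
    rw [h.1, h.2]
    exact hS F'
  · rintro ⟨⟨w', S'⟩, h'⟩
    obtain ⟨F, hF⟩ := exists_flag ℓ hl w' S' h'
    refine ⟨Quot.mk _ F, ?_⟩
    have := HasType.unique (hT F) h' (hS F) hF
    simp [this.1, this.2]

def idxZ (ℓ : ℕ) (i : Fin (2 * ℓ)) : ℤ := if i.val < ℓ then (i.val : ℤ) + 1 else (i.val : ℤ) - 2 * ℓ

lemma idxZ_inj {ℓ : ℕ} {i j : Fin (2 * ℓ)} (h : idxZ ℓ i = idxZ ℓ j) : i = j := by
  have := i.isLt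
  have := j.isLt
  unfold idxZ at h
  apply Fin.ext
  split_ifs at h <;> omega

lemma idxZ_rev {ℓ : ℕ} (i : Fin (2 * ℓ)) : idxZ ℓ i.rev = - idxZ ℓ i := by
  have := i.isLt
  unfold idxZ
  rw [Fin.val_rev]
  split_ifs <;> omega

lemma idxZ_bd {ℓ : ℕ} (i : Fin (2 * ℓ)) : 1 ≤ (idxZ ℓ i).natAbs ∧ (idxZ ℓ i).natAbs ≤ ℓ := by
  have := i.isLt
  unfold idxZ
  split_ifs <;> omega

lemma idxZ_surj {ℓ : ℕ} (z : ℤ) (h1 : 1 ≤ z.natAbs) (h2 : z.natAbs ≤ ℓ) : ∃ i, idxZ ℓ i = z := by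
  by_cases h : 0 < z
  · refine ⟨⟨(z - 1).toNat, by omega⟩, ?_⟩
    unfold idxZ
    rw [if_pos (by simp; omega)]
    simp; omega
  · refine ⟨⟨(z + 2 * ℓ).toNat, by omega⟩, ?_⟩
    unfold idxZ
    rw [if_neg (by simp; omega)]
    simp; omega

lemma idxZ_pos {ℓ : ℕ} {i : Fin (2 * ℓ)} : 0 < idxZ ℓ i ↔ i.val < ℓ := by
  have := i.isLt
  unfold idxZ
  split_ifs <;> omega

lemma idxZ_abs {ℓ : ℕ} {i : Fin (2 * ℓ)} : (idxZ ℓ i).natAbs = ℓ ↔ i.val = ℓ - 1 ∨ i.val = ℓ := by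
  have := i.isLt
  unfold idxZ
  split_ifs <;> omega

lemma idxZ_abs_eq {ℓ : ℕ} {i j : Fin (2 * ℓ)} (h : (idxZ ℓ i).natAbs = (idxZ ℓ j).natAbs) :
    i = j ∨ i = j.rev := by
  rcases Int.natAbs_eq_natAbs_iff.1 h with h | h
  · exact Or.inl (idxZ_inj h)
  · rw [← idxZ_rev] at h
    exact Or.inr (idxZ_inj h)

structure IsTT (ℓ : ℕ) (M : List ℤ) (S : Finset ℤ) : Prop where
  nd : (M.map Int.natAbs).Nodup
  cov : ∀ x, x ∈ M.map Int.natAbs ↔ 1 ≤ x ∧ x ≤ ℓ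
  last : 0 < M.getLastD 0
  Sm : ∀ x ∈ S, x ∈ M ∧ 0 < x ∧ x < ℓ
  ord : M.Pairwise (fun x y => y ∈ S → (x ∈ S ∨ x.natAbs = ℓ) → x.natAbs < y.natAbs)

def flp {ℓ : ℕ} (S : Finset (Fin (2 * ℓ))) (i : Fin (2 * ℓ)) : Fin (2 * ℓ) :=
  if i.rev ∈ S then i.rev else i

lemma getLastD_ofFn (ℓ : ℕ) (hl : 1 ≤ ℓ) (v : Fin ℓ → ℤ) :
    (List.ofFn v).getLastD 0 = v ⟨ℓ - 1, by omega⟩ := by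
  have hne : List.ofFn v ≠ [] := by
    intro h
    have := congrArg List.length h
    simp at this
    omega
  rw [List.getLastD_eq_getLast?, List.getLast?_eq_getLast_of_ne_nil hne]
  simp [List.getLast_eq_getElem]

lemma idxZ_flp_abs {ℓ : ℕ} (S : Finset (Fin (2 * ℓ))) (i : Fin (2 * ℓ)) :
    (idxZ ℓ (flp S i)).natAbs = (idxZ ℓ i).natAbs := by
  unfold flp
  split_ifs
  · rw [idxZ_rev, Int.natAbs_neg]
  · rfl

lemma IsT2.notMem {ℓ : ℕ} {w : Fin ℓ → Fin (2 * ℓ)} {S : Finset (Fin (2 * ℓ))}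
    (h : IsT2 ℓ w S) (a : Fin ℓ) : w a ∉ S := by
  intro ha
  obtain ⟨b, hb⟩ := h.Sex _ ha
  exact h.rv _ _ hb

lemma IsT2.flp_mem {ℓ : ℕ} {w : Fin ℓ → Fin (2 * ℓ)} {S : Finset (Fin (2 * ℓ))}
    (h : IsT2 ℓ w S) (a : Fin ℓ) : flp S (w a) ∈ S ↔ (w a).rev ∈ S := by
  unfold flp
  split_ifs with h1
  · simp [h1]
  · simp [h1, h.notMem]

lemma IsT2.isTT {ℓ : ℕ} (hl : 1 ≤ ℓ) {w : Fin ℓ → Fin (2 * ℓ)} {S : Finset (Fin (2 * ℓ))}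
    (h : IsT2 ℓ w S) : IsTT ℓ (List.ofFn fun a => idxZ ℓ (flp S (w a))) (S.image (idxZ ℓ)) := by
  have habs : ∀ a b, (idxZ ℓ (w a)).natAbs = (idxZ ℓ (w b)).natAbs → a = b := by
    intro a b hab
    rcases idxZ_abs_eq hab with h1 | h1
    · exact h.inj _ _ h1
    · exact absurd h1 (h.rv _ _)
  have hmem : ∀ i, idxZ ℓ i ∈ S.image (idxZ ℓ) ↔ i ∈ S := by
    intro i
    rw [Finset.mem_image]
    constructor
    · rintro ⟨j, hj, e⟩
      rwa [← idxZ_inj e]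
    · exact fun hi => ⟨i, hi, rfl⟩
  refine ⟨?_, ?_, ?_, ?_, ?_⟩
  · rw [List.map_ofFn, List.nodup_ofFn]
    intro a b hab
    simp only [Function.comp, idxZ_flp_abs] at hab
    exact habs a b hab
  · intro x
    rw [List.map_ofFn, List.mem_ofFn]
    constructor
    · rintro ⟨a, rfl⟩
      exact idxZ_bd _
    · intro hx
      let f : Fin ℓ → Finset.Icc 1 ℓ := fun a => ⟨(idxZ ℓ (w a)).natAbs, Finset.mem_Icc.2 (idxZ_bd _)⟩
      have hf : Function.Injective f := fun a b hab => habs a b (congrArg Subtype.val hab)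
      have hb : Function.Bijective f := by
        rw [Fintype.bijective_iff_injective_and_card]
        exact ⟨hf, by simp⟩
      obtain ⟨a, ha⟩ := hb.2 ⟨x, Finset.mem_Icc.2 hx⟩
      refine ⟨a, ?_⟩
      simp only [Function.comp, idxZ_flp_abs]
      exact congrArg Subtype.val ha
  · rw [getLastD_ofFn ℓ hl, idxZ_pos]
    have h1 := h.last ⟨ℓ - 1, by omega⟩ rfl
    unfold flp
    split_ifs with h2
    · have := h.Slt _ h2
      omega
    · exact h1
  · intro x hx
    obtain ⟨i, hi, rfl⟩ := Finset.mem_image.1 hx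
    have h1 := h.Slt _ hi
    obtain ⟨a, ha⟩ := h.Sex _ hi
    refine ⟨?_, ?_, ?_⟩
    · rw [List.mem_ofFn]
      refine ⟨a, ?_⟩
      simp only [ha, flp, Fin.rev_rev, if_pos hi]
    · rw [idxZ_pos]; omega
    · unfold idxZ
      rw [if_pos (by omega)]
      omega
  · rw [List.pairwise_ofFn]
    intro a b hab hb ha
    rw [hmem, h.flp_mem] at hb
    rw [hmem, h.flp_mem, idxZ_flp_abs, idxZ_abs] at ha
    rw [idxZ_flp_abs, idxZ_flp_abs]
    obtain ⟨o1, o2, o3⟩ := h.Sord a b (w b).rev hab hb (by simp)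
    rcases ha with ha | ha | ha
    · have h3 := o3 _ ha (by simp)
      have h4 := h.Slt _ hb
      have h5 := h.Slt _ ha
      rw [← Int.natAbs_neg (idxZ ℓ (w a)), ← Int.natAbs_neg (idxZ ℓ (w b)), ← idxZ_rev, ← idxZ_rev]
      unfold idxZ
      rw [if_pos (by omega), if_pos (by omega)]
      have := Fin.lt_def.1 h3
      omega
    · exact absurd ha o1
    · exact absurd ha o2

lemma card_T2 (ℓ : ℕ) (hl : 1 ≤ ℓ) :
    Nat.card {ws : (Fin ℓ → Fin (2 * ℓ)) × Finset (Fin (2 * ℓ)) // IsT2 ℓ ws.1 ws.2} =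
    Nat.card {ms : List ℤ × Finset ℤ // IsTT ℓ ms.1 ms.2} := by
  refine Nat.card_eq_of_bijective
    (fun ws => ⟨(List.ofFn fun a => idxZ ℓ (flp ws.1.2 (ws.1.1 a)), ws.1.2.image (idxZ ℓ)),
      ws.2.isTT hl⟩) ⟨?_, ?_⟩
  · rintro ⟨⟨w, S⟩, h⟩ ⟨⟨w', S'⟩, h'⟩ e
    simp only [Subtype.mk.injEq, Prod.mk.injEq] at e h h' ⊢
    obtain ⟨e1, e2⟩ := e
    have e3 : S = S' := Finset.image_injective (fun i j => idxZ_inj) e2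
    subst e3
    refine ⟨?_, rfl⟩
    have e4 := List.ofFn_injective e1
    funext a
    have e5 : flp S (w a) = flp S (w' a) := idxZ_inj (congrFun e4 a)
    have m1 := h.flp_mem a
    have m2 := h'.flp_mem a
    rw [e5] at m1
    by_cases hm : (w a).rev ∈ S
    · have hm' : (w' a).rev ∈ S := by tauto
      unfold flp at e5
      rw [if_pos hm, if_pos hm'] at e5
      exact Fin.rev_injective e5
    · have hm' : (w' a).rev ∉ S := by tauto
      unfold flp at e5
      rwa [if_neg hm, if_neg hm'] at e5
  · rintro ⟨⟨M, S'⟩, h⟩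
    simp only at h
    have hlen : M.length = ℓ := by
      have h1 : (M.map Int.natAbs).toFinset = Finset.Icc 1 ℓ := by
        ext x
        rw [List.mem_toFinset, h.cov, Finset.mem_Icc]
      have h2 := List.toFinset_card_of_nodup h.nd
      rw [h1] at h2
      simpa using h2.symm
    obtain ⟨v, rfl⟩ : ∃ v : Fin ℓ → ℤ, M = List.ofFn v := by
      subst hlen
      exact ⟨M.get, (List.ofFn_get M).symm⟩
    have hv : ∀ a, ∃ i, idxZ ℓ i = v a := by
      intro a
      have := (h.cov (v a).natAbs).1 (by simp only [List.map_ofFn, List.mem_ofFn]; exact ⟨a, rfl⟩)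
      exact idxZ_surj _ this.1 this.2
    choose u hu using hv
    let S : Finset (Fin (2 * ℓ)) := Finset.univ.filter fun i => idxZ ℓ i ∈ S'
    have hS : ∀ i, i ∈ S ↔ idxZ ℓ i ∈ S' := by intro i; simp [S]
    have hSpos : ∀ i ∈ S, i.val + 1 < ℓ := by
      intro i hi
      obtain ⟨-, h1, h2⟩ := h.Sm _ ((hS i).1 hi)
      rw [idxZ_pos] at h1
      unfold idxZ at h2
      rw [if_pos h1] at h2
      omega
    have hSr : ∀ i ∈ S, i.rev ∉ S := by
      intro i hi hi'
      have h1 := hSpos i hi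
      have h2 := hSpos _ hi'
      rw [Fin.val_rev] at h2
      omega
    let w : Fin ℓ → Fin (2 * ℓ) := fun a => if u a ∈ S then (u a).rev else u a
    have hwabs : ∀ a, (idxZ ℓ (w a)).natAbs = (v a).natAbs := by
      intro a
      simp only [w]
      split_ifs
      · rw [idxZ_rev, Int.natAbs_neg, hu]
      · rw [hu]
    have hvinj : ∀ a b, (v a).natAbs = (v b).natAbs → a = b := by
      have := h.nd
      rw [List.map_ofFn, List.nodup_ofFn] at this
      exact fun a b hab => this hab
    have hSu : ∀ i ∈ S, ∃ a, u a = i := by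
      intro i hi
      have := (h.Sm _ ((hS i).1 hi)).1
      rw [List.mem_ofFn] at this
      obtain ⟨a, ha⟩ := this
      exact ⟨a, idxZ_inj (by rw [hu, ha])⟩
    have hwrev : ∀ a j, j ∈ S → w a = j.rev → u a = j := by
      intro a j hj hw
      simp only [w] at hw
      split_ifs at hw with h1
      · exact Fin.rev_injective hw
      · exfalso
        obtain ⟨b, hb⟩ := hSu j hj
        have : a = b := hvinj a b (by rw [← hu, ← hu, hb, hw, idxZ_rev, Int.natAbs_neg])
        subst this
        exact h1 (hb ▸ hj)
    have ho := h.ord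
    rw [List.pairwise_ofFn] at ho
    have hT : IsT2 ℓ w S := by
      refine ⟨?_, ?_, ?_, hSpos, ?_, ?_⟩
      · intro a b hab
        exact hvinj a b (by rw [← hwabs, ← hwabs, hab])
      · intro a b hab
        have : a = b := hvinj a b (by rw [← hwabs, ← hwabs, hab, idxZ_rev, Int.natAbs_neg])
        subst this
        have := congrArg (idxZ ℓ) hab
        rw [idxZ_rev] at this
        have := idxZ_bd (w a)
        omega
      · intro a ha
        have h1 := h.last
        rw [getLastD_ofFn ℓ hl] at h1
        have h2 : (⟨ℓ - 1, by omega⟩ : Fin ℓ) = a := Fin.ext ha.symm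
        rw [h2, ← hu, idxZ_pos] at h1
        have h3 : u a ∉ S := by
          intro h3
          obtain ⟨b, hb⟩ : ∃ b, (v b).natAbs = ℓ := by
            have := (h.cov ℓ).2 ⟨hl, le_rfl⟩
            rw [List.map_ofFn, List.mem_ofFn] at this
            exact this
          have h4 := (hS _).1 h3
          have h5 := h.Sm _ h4
          rw [hu] at h4 h5
          have hne : b ≠ a := by
            rintro rfl
            omega
          have hlt : b < a := by
            rw [Fin.lt_def]
            have : b.val ≠ a.val := fun h => hne (Fin.ext h)
            omega
          have := ho hlt h4 (Or.inr hb)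
          omega
        simp only [w, if_neg h3]
        exact h1
      · intro i hi
        obtain ⟨a, ha⟩ := hSu i hi
        exact ⟨a, by simp only [w]; rw [ha, if_pos hi]⟩
      · intro a b j hab hj hb
        have hub := hwrev b j hj hb
        have hbS : v b ∈ S' := by rw [← hu, hub]; exact (hS _).1 hj
        have hbm := h.Sm _ hbS
        have key : (v a).natAbs ≠ ℓ := by
          intro h1
          have := ho hab hbS (Or.inr h1)
          omega
        rw [← hwabs, Ne, idxZ_abs, not_or] at key
        refine ⟨key.1, key.2, ?_⟩
        intro i hi hwi
        have hua := hwrev a i hi hwi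
        have haS : v a ∈ S' := by rw [← hu, hua]; exact (hS _).1 hi
        have h1 := ho hab hbS (Or.inl haS)
        rw [← hu, ← hu, hua, hub] at h1
        have h2 := hSpos i hi
        have h3 := hSpos j hj
        unfold idxZ at h1
        rw [if_pos (by omega), if_pos (by omega)] at h1
        rw [Fin.lt_def]
        omega
    refine ⟨⟨(w, S), hT⟩, ?_⟩
    simp only [Subtype.mk.injEq, Prod.mk.injEq]
    constructor
    · congr 1
      funext a
      rw [← hu]
      congr 1
      by_cases h1 : u a ∈ S
      · simp [flp, w, h1]
      · have h2 : (u a).rev ∉ S := by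
          intro h2
          obtain ⟨b, hb⟩ := hSu _ h2
          have : a = b := hvinj a b (by rw [← hu, ← hu, hb, idxZ_rev, Int.natAbs_neg])
          subst this
          exact rev_ne ℓ _ hb
        simp [flp, w, h1, h2]
    · ext z
      rw [Finset.mem_image]
      constructor
      · rintro ⟨i, hi, rfl⟩
        exact (hS i).1 hi
      · intro hz
        have h1 := (h.Sm z hz).1
        rw [List.mem_ofFn] at h1
        obtain ⟨a, rfl⟩ := h1
        exact ⟨u a, (hS _).2 (by rw [hu]; exact hz), hu a⟩


def spkey (ℓ : ℕ) (l : List ℤ) : ℕ :=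
  if ∃ x ∈ l, x.natAbs = ℓ then ℓ else (l.getLastD 0).natAbs

structure IsSeq (ℓ : ℕ) (Ls : List (List ℤ)) : Prop where
  nn : ∀ l ∈ Ls, l ≠ []
  pos : ∀ l ∈ Ls, 0 < l.getLastD 0
  nd : ∀ l ∈ Ls, (l.map Int.natAbs).Nodup
  dj : ∀ l ∈ Ls, ∀ l' ∈ Ls, ∀ x ∈ l, ∀ y ∈ l', x.natAbs = y.natAbs → l = l'
  cov : ∀ n, (∃ l ∈ Ls, ∃ x ∈ l, x.natAbs = n) ↔ 1 ≤ n ∧ n ≤ ℓ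
  srt : Ls.Pairwise (fun l l' => spkey ℓ l < spkey ℓ l')

lemma lastD_append (d : List ℤ) (b : ℤ) : (d ++ [b]).getLastD 0 = b := by
  simp [List.getLastD_eq_getLast?]

lemma lastD_mem {l : List ℤ} (h : l ≠ []) : l.getLastD 0 ∈ l := by
  rcases List.eq_nil_or_concat' l with rfl | ⟨d, b, rfl⟩
  · exact absurd rfl h
  · rw [lastD_append]; simp

lemma lastD_eq_getLast {l : List ℤ} (h : l ≠ []) : l.getLast h = l.getLastD 0 := by
  simp [List.getLastD_eq_getLast?, List.getLast?_eq_getLast_of_ne_nil h]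

lemma spkey_mem {ℓ : ℕ} {l : List ℤ} (h : l ≠ []) : ∃ x ∈ l, x.natAbs = spkey ℓ l := by
  unfold spkey
  split_ifs with h1
  · exact h1
  · exact ⟨_, lastD_mem h, rfl⟩

lemma pw_last {l : List ℤ} (h : (l.map Int.natAbs).Nodup) :
    l.Pairwise (fun x _ => x.natAbs ≠ (l.getLastD 0).natAbs) := by
  rcases List.eq_nil_or_concat' l with rfl | ⟨d, b, rfl⟩
  · exact List.Pairwise.nil
  · rw [lastD_append]
    have h1 : ∀ x ∈ d, x.natAbs ≠ b.natAbs := by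
      rw [List.Nodup, List.pairwise_map, List.pairwise_append] at h
      exact fun x hx => h.2.2 x hx b (by simp)
    rw [List.pairwise_append]
    refine ⟨?_, by simp, fun x hx _ _ => h1 x hx⟩
    rw [List.pairwise_iff_forall_sublist]
    intro x y hxy
    exact h1 x (hxy.subset (by simp))

lemma chain_dropLast {α : Type} {P : α → Prop} (d : List α) (b : α)
    (h : (d ++ [b]).IsChain (fun x _ => P x)) : ∀ x ∈ d, P x := by
  induction d with
  | nil => simp
  | cons a d ih =>
    rw [List.cons_append, List.isChain_cons] at h
    intro x hx
    rcases List.mem_cons.1 hx with rfl | hx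
    · cases d with
      | nil => exact h.1 b (by simp)
      | cons c d => exact h.1 c (by simp)
    · exact ih h.2 x hx

lemma lastD_flatten (init : List (List ℤ)) (L : List ℤ) (hL : L ≠ []) :
    (init ++ [L]).flatten.getLastD 0 = L.getLastD 0 := by
  rcases List.eq_nil_or_concat' L with rfl | ⟨d, b, rfl⟩
  · exact absurd rfl hL
  · rw [lastD_append, List.flatten_append, List.flatten_singleton, ← List.append_assoc,
      lastD_append]

lemma IsSeq.bd {ℓ : ℕ} {Ls : List (List ℤ)} (h : IsSeq ℓ Ls) {l : List ℤ} (hl : l ∈ Ls) {x : ℤ}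
    (hx : x ∈ l) : 1 ≤ x.natAbs ∧ x.natAbs ≤ ℓ := (h.cov _).1 ⟨l, hl, x, hx, rfl⟩

lemma IsSeq.key_le {ℓ : ℕ} {Ls : List (List ℤ)} (h : IsSeq ℓ Ls) {l : List ℤ} (hl : l ∈ Ls) :
    spkey ℓ l ≤ ℓ := by
  obtain ⟨x, hx, e⟩ := spkey_mem (ℓ := ℓ) (h.nn l hl)
  rw [← e]
  exact (h.bd hl hx).2

lemma IsSeq.key_inj {ℓ : ℕ} {Ls : List (List ℤ)} (h : IsSeq ℓ Ls) {l l' : List ℤ} (hl : l ∈ Ls)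
    (hl' : l' ∈ Ls) (e : spkey ℓ l = spkey ℓ l') : l = l' := by
  obtain ⟨x, hx, ex⟩ := spkey_mem (ℓ := ℓ) (h.nn l hl)
  obtain ⟨y, hy, ey⟩ := spkey_mem (ℓ := ℓ) (h.nn l' hl')
  exact h.dj l hl l' hl' x hx y hy (by rw [ex, ey, e])

lemma IsSeq.nodup {ℓ : ℕ} {Ls : List (List ℤ)} (h : IsSeq ℓ Ls) : Ls.Nodup :=
  h.srt.imp fun hab e => by subst e; exact lt_irrefl _ hab

lemma IsSeq.isSPIL {ℓ : ℕ} {Ls : List (List ℤ)} (h : IsSeq ℓ Ls) :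
    IsSPIL (Finset.Icc 1 ℓ) Ls.toFinset := by
  refine ⟨?_, ?_, ?_⟩
  · intro l hl
    rw [List.mem_toFinset] at hl
    refine ⟨h.nn l hl, ?_, h.nd l hl, h.pos l hl⟩
    intro x hx
    have := h.bd hl hx
    exact ⟨by omega, Finset.mem_Icc.2 this⟩
  · intro l hl l' hl' hne
    rw [List.mem_toFinset] at hl hl'
    rw [Finset.disjoint_left]
    intro n hn hn'
    simp only [List.mem_toFinset, List.mem_map] at hn hn'
    obtain ⟨x, hx, rfl⟩ := hn
    obtain ⟨y, hy, e⟩ := hn'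
    exact hne (h.dj l hl l' hl' x hx y hy e.symm)
  · ext n
    rw [Finset.mem_Icc, ← h.cov]
    simp

lemma card_seq (ℓ : ℕ) :
    Nat.card {Ls : List (List ℤ) // IsSeq ℓ Ls} = spilCount ℓ := by
  unfold spilCount
  rw [← Nat.card_coe_set_eq]
  refine Nat.card_eq_of_bijective (fun Ls => ⟨Ls.1.toFinset, Ls.2.isSPIL⟩) ⟨?_, ?_⟩
  · rintro ⟨Ls, h⟩ ⟨Ls', h'⟩ e
    simp only [Subtype.mk.injEq] at e ⊢
    refine List.Perm.eq_of_pairwise ?_ h.srt h'.srt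
      (List.perm_of_nodup_nodup_toFinset_eq h.nodup h'.nodup e)
    intro a b _ _ h1 h2
    exact absurd h1 (lt_asymm h2)
  · rintro ⟨P, hP⟩
    obtain ⟨h1, h2, h3⟩ := hP
    let Ls := P.toList.mergeSort (fun l l' => decide (spkey ℓ l ≤ spkey ℓ l'))
    have hperm : Ls.Perm P.toList := List.mergeSort_perm _ _
    have hmem : ∀ l, l ∈ Ls ↔ l ∈ P := fun l => by rw [hperm.mem_iff, Finset.mem_toList]
    have hnd : Ls.Nodup := hperm.nodup_iff.2 P.nodup_toList
    have hs : Ls.Pairwise (fun l l' => spkey ℓ l ≤ spkey ℓ l') := by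
      have := List.pairwise_mergeSort (le := fun l l' => decide (spkey ℓ l ≤ spkey ℓ l'))
        (by intro a b c; simp only [decide_eq_true_eq]; exact le_trans)
        (by intro a b; simp only [Bool.or_eq_true, decide_eq_true_eq]; exact le_total _ _) P.toList
      exact this.imp fun h => by simpa using h
    have hdj : ∀ l ∈ Ls, ∀ l' ∈ Ls, ∀ x ∈ l, ∀ y ∈ l', x.natAbs = y.natAbs → l = l' := by
      intro l hl l' hl' x hx y hy e
      by_contra hne
      have := h2 l ((hmem l).1 hl) l' ((hmem l').1 hl') hne
      rw [Finset.disjoint_left] at this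
      refine this (a := x.natAbs) ?_ ?_
      · simp only [List.mem_toFinset, List.mem_map]
        exact ⟨x, hx, rfl⟩
      · simp only [List.mem_toFinset, List.mem_map]
        exact ⟨y, hy, e.symm⟩
    have hnn : ∀ l ∈ Ls, l ≠ [] := fun l hl => (h1 l ((hmem l).1 hl)).1
    have hseq : IsSeq ℓ Ls := by
      refine ⟨hnn, fun l hl => (h1 l ((hmem l).1 hl)).2.2.2,
        fun l hl => (h1 l ((hmem l).1 hl)).2.2.1, hdj, ?_, ?_⟩
      · intro n
        rw [← Finset.mem_Icc, ← h3]
        simp [hmem]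
      · refine (hs.and hnd).imp_of_mem ?_
        rintro a b ha hb ⟨hab, hne⟩
        refine lt_of_le_of_ne hab fun e => hne ?_
        obtain ⟨x, hx, ex⟩ := spkey_mem (ℓ := ℓ) (hnn a ha)
        obtain ⟨y, hy, ey⟩ := spkey_mem (ℓ := ℓ) (hnn b hb)
        exact hdj a ha b hb x hx y hy (by rw [ex, ey, e])
    refine ⟨⟨Ls, hseq⟩, ?_⟩
    simp only [Subtype.mk.injEq]
    ext l
    rw [List.mem_toFinset, hmem]

def lastSet (ℓ : ℕ) (Ls : List (List ℤ)) : Finset ℤ :=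
  ((Ls.filter fun l => decide (¬ ∃ x ∈ l, x.natAbs = ℓ)).map fun l => l.getLastD 0).toFinset

lemma mem_lastSet {ℓ : ℕ} {Ls : List (List ℤ)} {x : ℤ} :
    x ∈ lastSet ℓ Ls ↔ ∃ l ∈ Ls, (¬ ∃ y ∈ l, y.natAbs = ℓ) ∧ l.getLastD 0 = x := by
  simp only [lastSet, List.mem_toFinset, List.mem_map, List.mem_filter, decide_eq_true_eq]
  constructor
  · rintro ⟨l, ⟨h1, h2⟩, h3⟩
    exact ⟨l, h1, h2, h3⟩
  · rintro ⟨l, h1, h2, h3⟩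
    exact ⟨l, ⟨h1, h2⟩, h3⟩

/-- An element of the set of last entries lying in a list is the last entry of that list. -/
lemma IsSeq.lastSet_in {ℓ : ℕ} {Ls : List (List ℤ)} (h : IsSeq ℓ Ls) {l : List ℤ} (hl : l ∈ Ls)
    {x : ℤ} (hx : x ∈ l) (hS : x ∈ lastSet ℓ Ls) :
    x = l.getLastD 0 ∧ ¬ ∃ y ∈ l, y.natAbs = ℓ := by
  obtain ⟨l', hl', h1, h2⟩ := mem_lastSet.1 hS
  have : l' = l := by
    refine h.dj l' hl' l hl _ (lastD_mem (h.nn _ hl')) x hx ?_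
    rw [h2]
  subst this
  exact ⟨h2.symm, h1⟩

lemma IsSeq.flat_nd {ℓ : ℕ} {Ls : List (List ℤ)} (h : IsSeq ℓ Ls) :
    (Ls.flatten.map Int.natAbs).Nodup := by
  rw [List.Nodup, List.pairwise_map, List.pairwise_flatten]
  constructor
  · intro l hl
    have := h.nd l hl
    rwa [List.Nodup, List.pairwise_map] at this
  · refine h.nodup.imp_of_mem ?_
    intro a b ha hb hne x hx y hy e
    exact hne (h.dj a ha b hb x hx y hy e)

lemma IsSeq.isTT {ℓ : ℕ} (hl1 : 1 ≤ ℓ) {Ls : List (List ℤ)} (h : IsSeq ℓ Ls) :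
    IsTT ℓ Ls.flatten (lastSet ℓ Ls) := by
  refine ⟨h.flat_nd, ?_, ?_, ?_, ?_⟩
  · intro n
    rw [← h.cov]
    simp only [List.mem_map, List.mem_flatten]
    constructor
    · rintro ⟨x, ⟨l, hl, hx⟩, e⟩
      exact ⟨l, hl, x, hx, e⟩
    · rintro ⟨l, hl, x, hx, e⟩
      exact ⟨x, ⟨l, hl, hx⟩, e⟩
  · rcases List.eq_nil_or_concat' Ls with rfl | ⟨d, L, rfl⟩
    · obtain ⟨l, hl, -⟩ := (h.cov ℓ).2 ⟨hl1, le_rfl⟩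
      simp at hl
    · rw [lastD_flatten _ _ (h.nn L (by simp))]
      exact h.pos L (by simp)
  · intro x hx
    obtain ⟨l, hl, h1, rfl⟩ := mem_lastSet.1 hx
    have hm := lastD_mem (h.nn l hl)
    refine ⟨List.mem_flatten.2 ⟨l, hl, hm⟩, h.pos l hl, ?_⟩
    have := h.bd hl hm
    have h3 := h.pos l hl
    have : (l.getLastD 0).natAbs ≠ ℓ := fun e => h1 ⟨_, hm, e⟩
    omega
  · rw [List.pairwise_flatten]
    constructor
    · intro l hl
      refine (pw_last (h.nd l hl)).imp_of_mem ?_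
      intro x y hx hy hne hyS hxS
      obtain ⟨e1, e2⟩ := h.lastSet_in hl hy hyS
      rcases hxS with hxS | hxS
      · exact absurd (by rw [(h.lastSet_in hl hx hxS).1]) hne
      · exact absurd ⟨x, hx, hxS⟩ e2
    · refine h.srt.imp_of_mem ?_
      intro a b ha hb hab x hx y hy hyS hxS
      obtain ⟨e1, e2⟩ := h.lastSet_in hb hy hyS
      have kb : spkey ℓ b = y.natAbs := by
        unfold spkey
        rw [if_neg e2, e1]
      rw [← kb]
      rcases hxS with hxS | hxS
      · obtain ⟨e3, e4⟩ := h.lastSet_in ha hx hxS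
        have ka : spkey ℓ a = x.natAbs := by
          unfold spkey
          rw [if_neg e4, e3]
        rwa [← ka]
      · have ka : spkey ℓ a = ℓ := by
          unfold spkey
          rw [if_pos ⟨x, hx, hxS⟩]
        omega

lemma IsSeq.split {ℓ : ℕ} {Ls : List (List ℤ)} (h : IsSeq ℓ Ls) :
    Ls.flatten.splitBy (fun a _ => decide (a ∉ lastSet ℓ Ls)) = Ls := by
  refine List.splitBy_flatten (fun h0 => h.nn _ h0 rfl) ?_ ?_
  · intro l hl
    refine ((pw_last (h.nd l hl)).imp_of_mem ?_).isChain
    intro x y hx hy hne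
    rw [decide_eq_true_eq]
    intro hS
    exact hne (by rw [(h.lastSet_in hl hx hS).1])
  · refine (h.srt.imp_of_mem ?_).isChain
    intro a b ha hb hab
    refine ⟨h.nn a ha, h.nn b hb, ?_⟩
    rw [decide_eq_false_iff_not, not_not, lastD_eq_getLast, mem_lastSet]
    refine ⟨a, ha, ?_, rfl⟩
    intro h1
    have h2 := h.key_le hb
    have h3 : spkey ℓ a = ℓ := by
      unfold spkey
      rw [if_pos h1]
    omega

lemma card_TT (ℓ : ℕ) (hl1 : 1 ≤ ℓ) :
    Nat.card {ms : List ℤ × Finset ℤ // IsTT ℓ ms.1 ms.2} =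
    Nat.card {Ls : List (List ℤ) // IsSeq ℓ Ls} := by
  symm
  refine Nat.card_eq_of_bijective
    (fun Ls => ⟨(Ls.1.flatten, lastSet ℓ Ls.1), Ls.2.isTT hl1⟩) ⟨?_, ?_⟩
  · rintro ⟨Ls, h⟩ ⟨Ls', h'⟩ e
    simp only [Subtype.mk.injEq, Prod.mk.injEq] at e ⊢
    rw [← h.split, ← h'.split, e.1, e.2]
  · rintro ⟨⟨M, S⟩, h⟩
    simp only at h
    have hMne : M ≠ [] := by
      rintro rfl
      have := h.last
      simp at this
    obtain ⟨Ls, hLs⟩ : ∃ Ls, Ls = M.splitBy (fun a _ => decide (a ∉ S)) := ⟨_, rfl⟩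
    have hflat : Ls.flatten = M := by rw [hLs, List.flatten_splitBy]
    have hnn : ∀ l ∈ Ls, l ≠ [] := fun l hl => by
      rw [hLs] at hl
      exact List.ne_nil_of_mem_splitBy hl
    have hch : ∀ l ∈ Ls, l.IsChain fun x _ => x ∉ S := fun l hl => by
      rw [hLs] at hl
      exact (List.isChain_of_mem_splitBy hl).imp fun _ _ h => by simpa using h
    have hch2 : Ls.IsChain fun a _ => a.getLastD 0 ∈ S := by
      rw [hLs]
      refine (List.isChain_getLast_head_splitBy _ M).imp ?_
      rintro a b ⟨ha, hb, h1⟩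
      rwa [decide_eq_false_iff_not, not_not, lastD_eq_getLast] at h1
    have hLne : Ls ≠ [] := by
      rintro rfl
      exact hMne (by rw [← hflat]; rfl)
    -- an element of S lying in a list is its last entry
    have hSl : ∀ l ∈ Ls, ∀ x ∈ l, x ∈ S → x = l.getLastD 0 := by
      intro l hl x hx hxS
      have h1 := hch l hl
      rcases List.eq_nil_or_concat' l with rfl | ⟨d, b, rfl⟩
      · simp at hx
      · rw [lastD_append]
        rcases List.mem_append.1 hx with hx | hx
        · exact absurd hxS (chain_dropLast d b h1 x hx)
        · simpa using hx
    have hord := h.ord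
    rw [← hflat, List.pairwise_flatten] at hord
    obtain ⟨ho1, ho2⟩ := hord
    have hmemM : ∀ l ∈ Ls, ∀ x ∈ l, x ∈ M := fun l hl x hx => by
      rw [← hflat]
      exact List.mem_flatten.2 ⟨l, hl, hx⟩
    -- a list whose last entry is in S contains no entry of absolute value ℓ
    have hnoℓ : ∀ l ∈ Ls, l.getLastD 0 ∈ S → ¬ ∃ y ∈ l, y.natAbs = ℓ := by
      rintro l hl hS ⟨y, hy, e⟩
      have h1 := ho1 l hl
      have h2 := h.Sm _ hS
      rcases List.eq_nil_or_concat' l with rfl | ⟨d, b, rfl⟩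
      · simp at hy
      · rw [lastD_append] at hS h2
        rcases List.mem_append.1 hy with hy | hy
        · have := (List.pairwise_append.1 h1).2.2 y hy b (by simp) hS (Or.inr e)
          omega
        · have : y = b := by simpa using hy
          subst this
          omega
    have hnd := h.nd
    rw [← hflat, List.Nodup, List.pairwise_map, List.pairwise_flatten] at hnd
    obtain ⟨hn1, hn2⟩ := hnd
    rcases List.eq_nil_or_concat' Ls with h0 | ⟨init, L, hIL⟩
    · exact absurd h0 hLne
    have hinit : ∀ l ∈ init, l.getLastD 0 ∈ S := by
      rw [hIL] at hch2
      exact chain_dropLast init L hch2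
    have hLin : L ∈ Ls := by rw [hIL]; simp
    have hLℓ : ∃ y ∈ L, y.natAbs = ℓ := by
      have h1 := (h.cov ℓ).2 ⟨hl1, le_rfl⟩
      rw [List.mem_map, ← hflat] at h1
      obtain ⟨y, hy, e⟩ := h1
      obtain ⟨l, hl, hyl⟩ := List.mem_flatten.1 hy
      have hl' := hl
      rw [hIL] at hl'
      rcases List.mem_append.1 hl' with h2 | h2
      · exact absurd ⟨y, hyl, e⟩ (hnoℓ l hl (hinit l h2))
      · have : l = L := by simpa using h2
        subst this
        exact ⟨y, hyl, e⟩
    have hcase : ∀ l ∈ Ls, l = L ∨ l ∈ init := by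
      intro l hl
      rw [hIL] at hl
      rcases List.mem_append.1 hl with h2 | h2
      · exact Or.inr h2
      · exact Or.inl (by simpa using h2)
    have hkeyinit : ∀ l ∈ init, spkey ℓ l = (l.getLastD 0).natAbs := by
      intro l hl
      have hl' : l ∈ Ls := by rw [hIL]; simp [hl]
      unfold spkey
      rw [if_neg (hnoℓ l hl' (hinit l hl))]
    have hseq : IsSeq ℓ Ls := by
      refine ⟨hnn, ?_, ?_, ?_, ?_, ?_⟩
      · intro l hl
        rcases hcase l hl with rfl | h1
        · have := h.last
          rwa [← hflat, hIL, lastD_flatten _ _ (hnn l hl)] at this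
        · exact (h.Sm _ (hinit l h1)).2.1
      · intro l hl
        rw [List.Nodup, List.pairwise_map]
        exact hn1 l hl
      · intro l hl l' hl' x hx y hy e
        by_contra hne
        have : Std.Symm (fun l₁ l₂ : List ℤ => ∀ x ∈ l₁, ∀ y ∈ l₂, x.natAbs ≠ y.natAbs) :=
          ⟨fun a b hab x hx y hy e => hab y hy x hx e.symm⟩
        exact hn2.forall hl hl' hne x hx y hy e
      · intro n
        rw [← h.cov n, ← hflat]
        simp only [List.mem_map, List.mem_flatten]
        constructor
        · rintro ⟨l, hl, x, hx, e⟩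
          exact ⟨x, ⟨l, hl, hx⟩, e⟩
        · rintro ⟨x, ⟨l, hl, hx⟩, e⟩
          exact ⟨l, hl, x, hx, e⟩
      · rw [hIL, List.pairwise_append]
        refine ⟨?_, by simp, ?_⟩
        · rw [hIL, List.pairwise_append] at ho2
          refine ho2.1.imp_of_mem ?_
          intro a b ha hb hab
          rw [hkeyinit a ha, hkeyinit b hb]
          have ha' : a ∈ Ls := by rw [hIL]; simp [ha]
          have hb' : b ∈ Ls := by rw [hIL]; simp [hb]
          exact hab _ (lastD_mem (hnn a ha')) _ (lastD_mem (hnn b hb')) (hinit b hb)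
            (Or.inl (hinit a ha))
        · intro a ha b hb
          have : b = L := by simpa using hb
          subst this
          have hk : spkey ℓ b = ℓ := by
            unfold spkey
            rw [if_pos hLℓ]
          rw [hk, hkeyinit a ha]
          have := h.Sm _ (hinit a ha)
          omega
    refine ⟨⟨Ls, hseq⟩, ?_⟩
    simp only [Subtype.mk.injEq, Prod.mk.injEq]
    refine ⟨hflat, ?_⟩
    ext x
    rw [mem_lastSet]
    constructor
    · rintro ⟨l, hl, h1, rfl⟩
      rcases hcase l hl with rfl | h2
      · exact absurd hLℓ h1
      · exact hinit l h2
    · intro hx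
      have h1 := (h.Sm x hx).1
      rw [← hflat] at h1
      obtain ⟨l, hl, hxl⟩ := List.mem_flatten.1 h1
      have h2 := hSl l hl x hxl hx
      exact ⟨l, hl, hnoℓ l hl (h2 ▸ hx), h2.symm⟩

/-- The number of `B_{SO(2ℓ-1)}`-orbits on the set of isotropic flags of
type D in `ℂ^{2ℓ}` equals `|SPIL(ℓ)|`. -/
theorem statement1 (ℓ : ℕ) (hl : 1 ≤ ℓ) :
    Nat.card (Quot (flagDRel ℓ hl)) = spilCount ℓ := by
  rw [card_quot, card_T2 ℓ hl, card_TT ℓ hl, card_seq]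

end
end
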